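/- arXiv:1512.06025 — 4 statements merged into one kernel-verified Lean document; each statement's English description precedes it below -/
import Mathlib

section
/- Spectrum of the Bernstein mass matrix (Derriennic): let d ≥ 1 and N ≥ 0. The set of eigenvalues of the degree-N Bernstein mass matrix M^N on the unit d-simplex equals { (N!)² / ((N+i+d)! · (N−i)!) : 0 ≤ i ≤ N }; in particular M^N has exactly N+1 distinct eigenvalues. -/
open MeasureTheory

/-- The unit `n`-simplex `T_n = {x ∈ ℝ^n : x_i ≥ 0, Σ x_i ≤ 1}`. -/
def unitSimplex (n : ℕ) : Set (Fin n → ℝ) := {x | (∀ i, 0 ≤ x i) ∧ ∑ i, x i ≤ 1}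

/-- Barycentric coordinates `λ(x) = (x_1, …, x_n, 1 − Σ_i x_i)` of `x ∈ ℝ^n`. -/
noncomputable def bary (n : ℕ) (x : Fin n → ℝ) : Fin (n + 1) → ℝ :=
  Fin.snoc x (1 - ∑ i, x i)

/-- The Bernstein basis function `b^N_α(x) = (N!/∏_j α_j!) · ∏_j λ(x)_j^{α_j}` on `ℝ^n`,
for a multi-index `α : Fin (n+1) → ℕ`. -/
noncomputable def bernFn (n N : ℕ) (α : Fin (n + 1) → ℕ) (x : Fin n → ℝ) : ℝ :=
  ((N.factorial : ℝ) / ∏ j, ((α j).factorial : ℝ)) * ∏ j, bary n x j ^ α j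

instance multiIndexFintype (n N : ℕ) : Fintype {α : Fin n → ℕ // ∑ j, α j = N} :=
  Fintype.ofFinset (Finset.Nat.antidiagonalTuple n N) fun x => by
    simp [Finset.Nat.mem_antidiagonalTuple]; rfl

/-- The degree-`N` Bernstein mass matrix `M^N` on the unit `d`-simplex, indexed by
multi-indices of weight `N`, with entries `M^N_{α,β} = ∫_{T_d} b^N_α b^N_β dx`. -/
noncomputable def massMatrix (d N : ℕ) :
    Matrix {α : Fin (d + 1) → ℕ // ∑ j, α j = N}
           {α : Fin (d + 1) → ℕ // ∑ j, α j = N} ℝ :=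
  fun α β => ∫ x in unitSimplex d, bernFn d N α.1 x * bernFn d N β.1 x


lemma beta_nat (a b : ℕ) (s : ℝ) : ∫ t in (0:ℝ)..s, t ^ a * (s - t) ^ b =
    s ^ (a + b + 1) * (a.factorial * b.factorial / (a + b + 1).factorial) := by
  induction a generalizing b with
  | zero =>
    have h : ∀ t ∈ Set.uIcc 0 s, HasDerivAt (fun t : ℝ => -((s - t) ^ (b+1) / (b+1))) (t ^ 0 * (s-t)^b) t := by
      intro t _
      have h1 : HasDerivAt (fun t : ℝ => s - t) (-1) t := by
        simpa using (hasDerivAt_id t).const_sub s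
      have h2 := ((h1.pow (b+1)).div_const ((b:ℝ)+1)).neg
      refine h2.congr_deriv ?_
      have hb : (b:ℝ) + 1 ≠ 0 := by positivity
      push_cast
      simp only [pow_zero]
      field_simp
    rw [intervalIntegral.integral_eq_sub_of_hasDerivAt h (by apply Continuous.intervalIntegrable; fun_prop)]
    simp [Nat.factorial_succ]
    have := Nat.factorial_ne_zero b
    field_simp
  | succ a ih =>
    have h : ∀ t ∈ Set.uIcc 0 s, HasDerivAt (fun t : ℝ => t ^ (a+1) * (s - t) ^ (b+1))
       ((a+1) * (t ^ a * (s-t)^(b+1)) - (b+1) * (t ^ (a+1) * (s-t)^b)) t := by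
      intro t _
      have h1 : HasDerivAt (fun t : ℝ => s - t) (-1) t := by
        simpa using (hasDerivAt_id t).const_sub s
      have h2 := ((hasDerivAt_id t).pow (a+1)).mul (h1.pow (b+1))
      refine h2.congr_deriv ?_
      push_cast
      simp only [Pi.pow_apply, id]
      ring
    have h3 := intervalIntegral.integral_eq_sub_of_hasDerivAt h (by apply Continuous.intervalIntegrable; fun_prop)
    rw [intervalIntegral.integral_sub (by apply Continuous.intervalIntegrable; fun_prop) (by apply Continuous.intervalIntegrable; fun_prop), intervalIntegral.integral_const_mul, intervalIntegral.integral_const_mul, ih (b+1)] at h3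
    simp at h3
    have hb : (b:ℝ) + 1 ≠ 0 := by positivity
    apply mul_left_cancel₀ hb
    have e : a + 1 + b + 1 = a + (b+1) + 1 := by ring
    rw [e, ← sub_eq_zero.mp h3]
    rw [Nat.factorial_succ a, Nat.factorial_succ b]
    push_cast
    ring

def sSimplex (d : ℕ) (s : ℝ) : Set (Fin d → ℝ) := {x | (∀ i, 0 ≤ x i) ∧ ∑ i, x i ≤ s}

lemma sSimplex_closed (d s) : IsClosed (sSimplex d s) := by
  have : sSimplex d s = (⋂ i, {x | 0 ≤ x i}) ∩ {x | ∑ i, x i ≤ s} := by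
    ext x; simp [sSimplex]
  rw [this]
  refine (isClosed_iInter fun i => isClosed_le (by fun_prop) (by fun_prop)).inter (isClosed_le (by fun_prop) (by fun_prop))

lemma sSimplex_compact (d s) : IsCompact (sSimplex d s) := by
  refine IsCompact.of_isClosed_subset (isCompact_Icc (a := (0 : Fin d → ℝ)) (b := fun _ => s)) (sSimplex_closed d s) ?_
  rintro x ⟨h1, h2⟩
  refine ⟨h1, fun i => le_trans ?_ h2⟩
  exact Finset.single_le_sum (fun i _ => h1 i) (Finset.mem_univ i)

lemma dirichlet (d : ℕ) (n : Fin d → ℕ) (m : ℕ) (s : ℝ) (hs : 0 ≤ s) :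
    ∫ x in sSimplex d s, (∏ i, x i ^ n i) * (s - ∑ i, x i) ^ m =
     s ^ (∑ i, n i + m + d) * ((∏ i, ((n i).factorial : ℝ)) * m.factorial / (∑ i, n i + m + d).factorial) := by
  induction d generalizing s with
  | zero =>
    have : sSimplex 0 s = Set.univ := by ext x; simp [sSimplex, hs]
    have h0 := Nat.factorial_ne_zero m
    rw [this]
    rw [Measure.volume_pi_eq_dirac (x := 0)] 
    simp
    field_simp
  | succ d ih =>
    rw [← integral_indicator (sSimplex_closed _ _).measurableSet]
    have mp := volume_preserving_piFinSuccAbove (fun _ : Fin (d+1) => ℝ) 0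
    have mp' := mp.symm
    have hfI : Integrable ((sSimplex (d+1) s).indicator fun x => (∏ i, x i ^ n i) * (s - ∑ i, x i) ^ m) volume := by
      rw [integrable_indicator_iff (sSimplex_closed _ _).measurableSet]
      exact ContinuousOn.integrableOn_compact (sSimplex_compact _ _) (by fun_prop)
    have hfI2 := mp'.integrable_comp_of_integrable hfI
    rw [← mp'.integral_comp (MeasurableEquiv.measurableEmbedding _)]
    rw [Measure.volume_eq_prod, integral_prod (fun z => (sSimplex (d+1) s).indicator (fun x => (∏ i, x i ^ n i) * (s - ∑ i, x i) ^ m) ((MeasurableEquiv.piFinSuccAbove (fun _ : Fin (d+1) => ℝ) 0).symm z)) hfI2]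
    have key : ∀ t : ℝ, (∫ y : Fin d → ℝ, (sSimplex (d+1) s).indicator (fun x => (∏ i, x i ^ n i) * (s - ∑ i, x i) ^ m) ((MeasurableEquiv.piFinSuccAbove (fun _ : Fin (d+1) => ℝ) 0).symm (t, y)))
       = (Set.Icc 0 s).indicator (fun t => (t ^ n 0 * (s - t) ^ (∑ i : Fin d, n i.succ + m + d)) * ((∏ i : Fin d, ((n i.succ).factorial : ℝ)) * m.factorial / (∑ i : Fin d, n i.succ + m + d).factorial)) t := by
      intro t
      by_cases ht : t ∈ Set.Icc 0 s
      · rw [Set.indicator_of_mem ht, mul_assoc, ← ih (fun i => n i.succ) (s-t) (by linarith [ht.2]),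
          ← integral_const_mul, ← integral_indicator (sSimplex_closed _ _).measurableSet]
        congr 1
        ext y
        have hy : (Fin.cons t y : Fin (d+1) → ℝ) ∈ sSimplex (d+1) s ↔ y ∈ sSimplex d (s-t) := by
          simp [sSimplex, Fin.forall_fin_succ, Fin.sum_univ_succ, ht.1, le_sub_iff_add_le']
        have e : (MeasurableEquiv.piFinSuccAbove (fun _ : Fin (d+1) => ℝ) 0).symm (t, y) = (Fin.cons t y : Fin (d+1) → ℝ) := by
          simp [MeasurableEquiv.piFinSuccAbove, Fin.insertNthEquiv]
        rw [e]
        by_cases h : y ∈ sSimplex d (s-t)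
        · rw [Set.indicator_of_mem h, Set.indicator_of_mem (hy.2 h)]
          simp [Fin.prod_univ_succ, Fin.sum_univ_succ, sub_sub, mul_assoc]
        · rw [Set.indicator_of_notMem h, Set.indicator_of_notMem (fun h' => h (hy.1 h'))]
      · rw [Set.indicator_of_notMem ht]
        refine integral_eq_zero_of_ae (Filter.Eventually.of_forall fun y => ?_)
        apply Set.indicator_of_notMem
        have e : (MeasurableEquiv.piFinSuccAbove (fun _ : Fin (d+1) => ℝ) 0).symm (t, y) = (Fin.cons t y : Fin (d+1) → ℝ) := by
          simp [MeasurableEquiv.piFinSuccAbove, Fin.insertNthEquiv]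
        rw [e]
        rintro ⟨h1, h2⟩
        apply ht
        rw [Fin.sum_univ_succ] at h2
        have := h1 0
        have h4 : 0 ≤ ∑ i : Fin d, (Fin.cons t y : Fin (d+1) → ℝ) i.succ := Finset.sum_nonneg fun i _ => h1 i.succ
        simp only [Fin.cons_zero] at this h2
        exact ⟨this, by linarith⟩
    simp_rw [key]
    rw [integral_indicator measurableSet_Icc, integral_Icc_eq_integral_Ioc, ← intervalIntegral.integral_of_le hs,
      intervalIntegral.integral_mul_const, beta_nat, Fin.sum_univ_succ, Fin.prod_univ_succ]
    have h0 := Nat.factorial_ne_zero (∑ i : Fin d, n i.succ + m + d)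
    have e : n 0 + (∑ i : Fin d, n i.succ + m + d) + 1 = n 0 + ∑ i : Fin d, n i.succ + m + (d+1) := by ring
    rw [e]
    field_simp

lemma massMatrix_apply (d N : ℕ) (α β) : massMatrix d N α β =
    (N.factorial : ℝ)^2 / (2 * N + d).factorial * ∏ j, ((α.1 j + β.1 j).choose (β.1 j) : ℝ) := by
  unfold massMatrix bernFn
  have h := dirichlet d (fun i => α.1 i.castSucc + β.1 i.castSucc) (α.1 (Fin.last d) + β.1 (Fin.last d)) 1 zero_le_one
  have e : ∀ x : Fin d → ℝ, ((N.factorial : ℝ) / ∏ j, ((α.1 j).factorial : ℝ)) * (∏ j, bary d x j ^ α.1 j) *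
    (((N.factorial : ℝ) / ∏ j, ((β.1 j).factorial : ℝ)) * ∏ j, bary d x j ^ β.1 j) =
     (((N.factorial : ℝ) / ∏ j, ((α.1 j).factorial : ℝ)) * ((N.factorial : ℝ) / ∏ j, ((β.1 j).factorial : ℝ))) *
     ((∏ i : Fin d, x i ^ (α.1 i.castSucc + β.1 i.castSucc)) * (1 - ∑ i, x i) ^ (α.1 (Fin.last d) + β.1 (Fin.last d))) := by
    intro x
    simp only [bary, Fin.prod_univ_castSucc (n := d) (f := fun j => Fin.snoc (α := fun _ => ℝ) x (1 - ∑ i, x i) j ^ _), Fin.snoc_castSucc, Fin.snoc_last, pow_add, Finset.prod_mul_distrib]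
    ring
  simp_rw [e]
  rw [integral_const_mul]
  have hu : unitSimplex d = sSimplex d 1 := rfl
  rw [hu, h]
  have hs : ∑ i : Fin d, (α.1 i.castSucc + β.1 i.castSucc) + (α.1 (Fin.last d) + β.1 (Fin.last d)) = 2 * N := by
    rw [← Fin.sum_univ_castSucc (f := fun j => α.1 j + β.1 j), Finset.sum_add_distrib, α.2, β.2]; ring
  rw [hs, ← Fin.prod_univ_castSucc (f := fun j => ((α.1 j + β.1 j).factorial : ℝ))]
  have hc : ∀ j, ((α.1 j + β.1 j).choose (β.1 j) : ℝ) = (α.1 j + β.1 j).factorial / ((α.1 j).factorial * (β.1 j).factorial) := by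
    intro j
    rw [Nat.cast_choose ℝ (Nat.le_add_left _ _)]
    simp [mul_comm]
  simp_rw [hc, Finset.prod_div_distrib, Finset.prod_mul_distrib]
  simp only [one_pow, one_mul]
  ring

/-- the candidate eigenvalues -/
noncomputable def mu (d N i : ℕ) : ℝ :=
  (N.factorial : ℝ) ^ 2 / (((N + i + d).factorial : ℝ) * ((N - i).factorial : ℝ))

/-- binomial basis vectors -/
def binVec (d N : ℕ) (γ : Fin (d + 1) → ℕ) : {α : Fin (d + 1) → ℕ // ∑ j, α j = N} → ℝ :=
  fun α => ∏ j, ((α.1 j).choose (γ j) : ℝ)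

open PowerSeries in
lemma prod_invOneSubPow {ι : Type*} (s : Finset ι) (n : ι → ℕ) :
    ∏ j ∈ s, ((invOneSubPow ℝ (n j)).val) = (invOneSubPow ℝ (∑ j ∈ s, n j)).val := by
  classical
  induction s using Finset.induction_on with
  | empty => simp [invOneSubPow_zero]
  | insert a s ha ih =>
    rw [Finset.prod_insert ha, Finset.sum_insert ha, ih, invOneSubPow_add, Units.val_mul]

open PowerSeries in
lemma coeff_prod_fin (k m : ℕ) (f : Fin k → PowerSeries ℝ) :
    coeff m (∏ j, f j) = ∑ β : {β : Fin k → ℕ // ∑ j, β j = m}, ∏ j, coeff (β.1 j) (f j) := by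
  rw [PowerSeries.coeff_prod]
  refine Finset.sum_bij' (i := fun l hl => (⟨fun j => l j, by simpa using hl⟩ : {β : Fin k → ℕ // ∑ j, β j = m}))
    (j := fun β _ => Finsupp.equivFunOnFinite.symm β.1) ?_ ?_ ?_ ?_ ?_
  · intro l hl; simp
  · intro β _
    simp [Finset.mem_finsuppAntidiag, β.2]
  · intro l hl; ext; simp
  · intro β hl; ext; simp
  · intro l hl; simp

lemma choose_id (a b c : ℕ) : (a + b).choose b * b.choose c =
    (a + c).choose c * (if c ≤ b then (a + c + (b - c)).choose (a + c) else 0) := by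
  split_ifs with h
  · obtain ⟨e, rfl⟩ := Nat.exists_eq_add_of_le h
    have := Nat.choose_mul (n := a + (c + e)) (k := c + e) (s := c) (by omega) 
    rw [this]
    have h2 := Nat.choose_mul (n := a + (c + e)) (k := a + c) (s := c) (by omega)
    have e1 : a + c + (c + e - c) = a + (c + e) := by omega
    rw [e1, mul_comm ((a+c).choose c), h2]
    congr 1
    have e2 : a + (c + e) - c = a + e := by omega
    rw [e2, Nat.add_sub_cancel_left, Nat.add_sub_cancel, add_comm a e, Nat.choose_symm_add]
  · rw [Nat.choose_eq_zero_of_lt (by omega : b < c)]; simp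

open PowerSeries in
lemma sum_choose (d N : ℕ) (α : {α : Fin (d + 1) → ℕ // ∑ j, α j = N}) (γ : Fin (d + 1) → ℕ)
    (h : ∑ j, γ j ≤ N) :
    ∑ β : {α : Fin (d + 1) → ℕ // ∑ j, α j = N},
      (∏ j, ((α.1 j + β.1 j).choose (β.1 j) : ℝ)) * ∏ j, ((β.1 j).choose (γ j) : ℝ)
    = (∏ j, ((α.1 j + γ j).choose (γ j) : ℝ)) * (2 * N + d).choose (N - ∑ j, γ j) := by
  have h1 := coeff_prod_fin (d+1) N (fun j => X ^ (γ j) * (invOneSubPow ℝ (α.1 j + γ j + 1)).val)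
  rw [Finset.prod_mul_distrib, Finset.prod_pow_eq_pow_sum, prod_invOneSubPow] at h1
  have e : ∑ j, (α.1 j + γ j + 1) = (N + ∑ j, γ j + d) + 1 := by
    simp [Finset.sum_add_distrib, α.2]; ring
  simp only [e, coeff_X_pow_mul', invOneSubPow_val_succ_eq_mk_add_choose, coeff_mk] at h1
  rw [if_pos h] at h1
  have e2 : N + ∑ j, γ j + d + (N - ∑ j, γ j) = 2 * N + d := by omega
  have e3 : (2 * N + d).choose (N - ∑ j, γ j) = (2*N+d).choose (N + ∑ j, γ j + d) :=
    Nat.choose_symm_of_eq_add (by omega)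
  rw [e2, ← e3] at h1
  rw [h1, Finset.mul_sum]
  refine Finset.sum_congr rfl fun β _ => ?_
  rw [← Finset.prod_mul_distrib, ← Finset.prod_mul_distrib]
  refine Finset.prod_congr rfl fun j _ => ?_
  exact_mod_cast choose_id (α.1 j) (β.1 j) (γ j)

lemma mass_mulVec (d N : ℕ) (γ : Fin (d + 1) → ℕ) (h : ∑ j, γ j ≤ N) :
    (massMatrix d N).mulVec (binVec d N γ) =
      mu d N (∑ j, γ j) • (fun α => ∏ j, ((α.1 j + γ j).choose (γ j) : ℝ)) := by
  ext α
  simp only [Matrix.mulVec, dotProduct, massMatrix_apply, binVec, Pi.smul_apply, smul_eq_mul, mul_assoc]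
  rw [← Finset.mul_sum, sum_choose d N α γ h, Nat.cast_choose ℝ (by omega)]
  have e : 2 * N + d - (N - ∑ j, γ j) = N + ∑ j, γ j + d := by omega
  rw [e, mu]
  have h0 := Nat.factorial_ne_zero (2 * N + d)
  field_simp

lemma choose_expand (a g : ℕ) : (a + g).choose g = ∑ l ∈ Finset.range (g+1), g.choose l * a.choose l := by
  rw [Nat.add_choose_eq, Finset.Nat.sum_antidiagonal_eq_sum_range_succ_mk]
  refine Finset.sum_congr rfl fun l hl => ?_
  rw [Nat.choose_symm (by simpa [Nat.lt_succ_iff] using hl), mul_comm]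

lemma mass_step (d N : ℕ) (γ : Fin (d + 1) → ℕ) (h : ∑ j, γ j ≤ N) :
    (massMatrix d N).mulVec (binVec d N γ) - mu d N (∑ j, γ j) • binVec d N γ ∈
      Submodule.span ℝ {v | ∃ p, p ≤ γ ∧ p ≠ γ ∧ v = binVec d N p} := by
  rw [mass_mulVec d N γ h, ← smul_sub]
  refine Submodule.smul_mem _ _ ?_
  have e : (fun α : {α : Fin (d + 1) → ℕ // ∑ j, α j = N} => ∏ j, ((α.1 j + γ j).choose (γ j) : ℝ)) =
      ∑ p ∈ Fintype.piFinset (fun j => Finset.range (γ j + 1)),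
        (∏ j, ((γ j).choose (p j) : ℝ)) • binVec d N p := by
    ext α
    simp only [choose_expand, Finset.sum_apply, Pi.smul_apply, smul_eq_mul, binVec]
    push_cast
    rw [Finset.prod_univ_sum]
    simp only [Finset.prod_mul_distrib]
  rw [e, Finset.sum_eq_add_sum_sdiff_singleton_of_mem (i := γ) (by simp)]
  simp only [Nat.choose_self, Nat.cast_one, Finset.prod_const_one, one_smul, add_sub_cancel_left]
  refine Submodule.sum_mem _ fun p hp => Submodule.smul_mem _ _ (Submodule.subset_span ?_)
  simp at hp
  exact ⟨p, hp.1, hp.2, rfl⟩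

lemma sum_lt_of {k : ℕ} {p γ : Fin k → ℕ} (h : p ≤ γ) (hne : p ≠ γ) : ∑ j, p j < ∑ j, γ j := by
  obtain ⟨j, hj⟩ := Function.ne_iff.mp hne
  exact Finset.sum_lt_sum (fun i _ => h i) ⟨j, Finset.mem_univ j, lt_of_le_of_ne (h j) hj⟩

/-- the degree filtration -/
def filt (d N k : ℕ) : Submodule ℝ ({α : Fin (d + 1) → ℕ // ∑ j, α j = N} → ℝ) :=
  Submodule.span ℝ {v | ∃ p : Fin (d+1) → ℕ, ∑ j, p j < k ∧ v = binVec d N p}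

lemma filt_step (d N i : ℕ) (hi : i ≤ N) (v) (hv : v ∈ filt d N (i+1)) :
    (massMatrix d N).mulVec v - mu d N i • v ∈ filt d N i := by
  induction hv using Submodule.span_induction with
  | zero => simp
  | add x y _ _ hx hy =>
    rw [Matrix.mulVec_add, smul_add, add_sub_add_comm]
    exact Submodule.add_mem _ hx hy
  | smul a x _ hx =>
    rw [Matrix.mulVec_smul, smul_comm, ← smul_sub]
    exact Submodule.smul_mem _ _ hx
  | mem x hx =>
    obtain ⟨γ, hγ, rfl⟩ := hx
    have h1 := mass_step d N γ (by omega)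
    have h2 : Submodule.span ℝ {v | ∃ p, p ≤ γ ∧ p ≠ γ ∧ v = binVec d N p} ≤ filt d N i := by
      refine Submodule.span_mono ?_
      rintro v ⟨p, hp, hne, rfl⟩
      exact ⟨p, by have := sum_lt_of hp hne; omega, rfl⟩
    have h3 := h2 h1
    rcases eq_or_lt_of_le (Nat.lt_succ_iff.mp hγ) with h | h
    · rwa [h] at h3
    · have h4 : binVec d N γ ∈ filt d N i := Submodule.subset_span ⟨γ, h, rfl⟩
      have h5 := Submodule.add_mem _ h3 (Submodule.smul_mem _ (mu d N (∑ j, γ j)) h4)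
      rw [sub_add_cancel] at h5
      exact Submodule.sub_mem _ h5 (Submodule.smul_mem _ _ h4)

lemma filt_top (d N : ℕ) (v) : v ∈ filt d N (N+1) := by
  classical
  have : v = ∑ γ : {α : Fin (d + 1) → ℕ // ∑ j, α j = N}, v γ • binVec d N γ.1 := by
    ext α
    rw [Finset.sum_apply, Finset.sum_eq_single α]
    · simp [binVec]
    · intro γ _ hne
      have : ∃ j, α.1 j < γ.1 j := by
        by_contra! hc
        have := sum_lt_of hc (fun h => hne (Subtype.ext h))
        rw [γ.2, α.2] at this
        omega
      obtain ⟨j, hj⟩ := this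
      simp only [Pi.smul_apply, binVec, smul_eq_mul]
      rw [Finset.prod_eq_zero (Finset.mem_univ j) (by rw [Nat.choose_eq_zero_of_lt hj]; simp), mul_zero]
    · simp
  rw [this]
  exact Submodule.sum_mem _ fun γ _ => Submodule.smul_mem _ _ (Submodule.subset_span ⟨γ.1, by rw [γ.2]; omega, rfl⟩)

lemma eig_upper (d N : ℕ) (r : ℝ) (v : {α : Fin (d + 1) → ℕ // ∑ j, α j = N} → ℝ) (hv : v ≠ 0)
    (h : (massMatrix d N).mulVec v = r • v) : ∃ i ≤ N, r = mu d N i := by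
  by_contra! hc
  apply hv
  have key : ∀ k ≤ N + 1, v ∈ filt d N (N + 1 - k) := by
    intro k
    induction k with
    | zero => intro _; exact filt_top d N v
    | succ k ih =>
      intro hk
      have h1 := ih (by omega)
      have e : N + 1 - k = (N - k) + 1 := by omega
      rw [e] at h1
      have h2 := filt_step d N (N - k) (by omega) v h1
      rw [h, ← sub_smul] at h2
      have e : N + 1 - (k + 1) = N - k := by omega
      rw [e]
      exact (Submodule.smul_mem_iff _ (sub_ne_zero.mpr (hc (N-k) (by omega)))).mp h2
  have := key (N+1) le_rfl
  simpa [filt] using this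

lemma eig_lower (d N i : ℕ) (hd : 1 ≤ d) (hi : i ≤ N) :
    ∃ v : {α : Fin (d + 1) → ℕ // ∑ j, α j = N} → ℝ, v ≠ 0 ∧
      (massMatrix d N).mulVec v = mu d N i • v := by
  classical
  let w : ℕ → ({α : Fin (d + 1) → ℕ // ∑ j, α j = N} → ℝ) := fun l => binVec d N (Pi.single 0 l)
  have hw : ∀ l α, w l α = (α.1 0).choose l := by
    intro l α
    simp only [w, binVec, Fin.prod_univ_succ]
    simp
  let W : Submodule ℝ ({α : Fin (d + 1) → ℕ // ∑ j, α j = N} → ℝ) :=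
    Submodule.span ℝ (Set.range fun l : Fin i => w l)
  have hstep : ∀ l ≤ i, (massMatrix d N).mulVec (w l) - mu d N i • w l ∈ W := by
    intro l hl
    have hs : ∑ j : Fin (d+1), (Pi.single 0 l : Fin (d+1) → ℕ) j = l := by simp
    have h1 := mass_step d N (Pi.single 0 l) (by rw [hs]; omega)
    rw [hs] at h1
    have h2 : Submodule.span ℝ {v | ∃ p, p ≤ (Pi.single 0 l : Fin (d+1) → ℕ) ∧ p ≠ Pi.single 0 l ∧ v = binVec d N p} ≤ W := by
      refine Submodule.span_mono ?_
      rintro v ⟨p, hp, hne, rfl⟩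
      have hp0 : p = Pi.single 0 (p 0) := by
        ext j
        refine Fin.cases ?_ (fun j => ?_) j
        · simp
        · have := hp j.succ
          simpa using this
      have := sum_lt_of hp hne
      rw [hs, hp0] at this
      simp only [Finset.sum_pi_single', Finset.mem_univ, if_true] at this
      refine ⟨⟨p 0, by omega⟩, ?_⟩
      show binVec d N (Pi.single 0 (p 0)) = _
      rw [← hp0]
    have h3 := h2 h1
    rcases eq_or_lt_of_le hl with h | h
    · rwa [← h]
    · have h4 : w l ∈ W := Submodule.subset_span ⟨⟨l, h⟩, rfl⟩
      have h5 := Submodule.add_mem _ h3 (Submodule.smul_mem _ (mu d N l) h4)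
      rw [sub_add_cancel] at h5
      exact Submodule.sub_mem _ h5 (Submodule.smul_mem _ _ h4)
  let L : (Fin (i+1) → ℝ) →ₗ[ℝ] ({α : Fin (d + 1) → ℕ // ∑ j, α j = N} → ℝ) :=
    Fintype.linearCombination ℝ (fun l : Fin (i+1) => w l)
  let T := ((massMatrix d N).mulVecLin - mu d N i • LinearMap.id) ∘ₗ L
  have hT : ∀ c, T c ∈ W := by
    intro c
    have : T c = ∑ l, c l • ((massMatrix d N).mulVec (w l) - mu d N i • w l) := by
      simp only [T, L, LinearMap.comp_apply, Fintype.linearCombination_apply, map_sum, map_smul]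
      simp
    rw [this]
    exact Submodule.sum_mem _ fun l _ => Submodule.smul_mem _ _ (hstep l (by omega))
  have hdim : Module.finrank ℝ W < Module.finrank ℝ (Fin (i+1) → ℝ) := by
    have := finrank_range_le_card (R := ℝ) (fun l : Fin i => w l)
    rw [Set.finrank] at this
    simp only [Fintype.card_fin] at this
    rw [Module.finrank_fin_fun]
    exact Nat.lt_succ_of_le this
  have hker := LinearMap.ker_ne_bot_of_finrank_lt (f := T.codRestrict W hT) hdim
  obtain ⟨c, hc, hc0⟩ := Submodule.exists_mem_ne_zero_of_ne_bot hker
  have hTc : T c = 0 := by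
    have := LinearMap.mem_ker.mp hc
    exact congrArg Subtype.val this
  refine ⟨L c, ?_, ?_⟩
  · intro hL
    apply hc0
    have key : ∀ a (ha : a < i + 1), c ⟨a, ha⟩ = 0 := by
      intro a
      induction a using Nat.strong_induction_on with
      | _ a ih =>
        intro ha
        have hsum : ∑ j : Fin (d+1), (Pi.single 0 a + Pi.single (Fin.last d) (N - a) : Fin (d+1) → ℕ) j = N := by
          simp [Finset.sum_add_distrib]; omega
        have h1 := congrFun hL ⟨_, hsum⟩
        have hne : (0 : Fin (d+1)) ≠ Fin.last d := by
          intro h; have := congrArg Fin.val h; simp at this; omega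
        simp only [L, Fintype.linearCombination_apply, Finset.sum_apply, Pi.smul_apply, hw, smul_eq_mul,
          Pi.add_apply, Pi.single_eq_same, Pi.single_eq_of_ne hne, add_zero, Pi.zero_apply] at h1
        rw [Finset.sum_eq_single ⟨a, ha⟩] at h1
        · simpa using h1
        · intro l _ hl
          rcases lt_trichotomy l.1 a with h | h | h
          · rw [show c l = 0 from ih l.1 h l.2, zero_mul]
          · exact absurd (Fin.ext h) hl
          · rw [Nat.choose_eq_zero_of_lt h]; simp
        · simp
    ext l
    exact key l.1 l.2
  · have : (massMatrix d N).mulVec (L c) - mu d N i • L c = 0 := hTc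
    exact sub_eq_zero.mp this

lemma mu_lt (d N i : ℕ) (hi : i + 1 ≤ N) : mu d N (i+1) < mu d N i := by
  obtain ⟨k, rfl⟩ := Nat.exists_eq_add_of_le hi
  unfold mu
  have e1 : i + 1 + k - (i + 1) = k := by omega
  have e2 : i + 1 + k - i = k + 1 := by omega
  have e3 : i + 1 + k + (i + 1) + d = (i + 1 + k + i + d) + 1 := by ring
  rw [e1, e2, e3, Nat.factorial_succ k, Nat.factorial_succ (i + 1 + k + i + d)]
  have p1 := Nat.factorial_pos k
  have p2 := Nat.factorial_pos (i + 1 + k + i + d)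
  have p3 := Nat.factorial_pos (i + 1 + k)
  apply div_lt_div_of_pos_left (by positivity) (by positivity)
  push_cast
  have q : (0:ℝ) < (i + 1 + k + i + d).factorial * k.factorial := by positivity
  have : (0:ℝ) < 2 * i + d + 1 := by positivity
  nlinarith [mul_pos q this]

lemma mu_anti (d N i j : ℕ) (hij : i < j) (hj : j ≤ N) : mu d N j < mu d N i := by
  induction j, hij using Nat.le_induction with
  | base => exact mu_lt d N i hj
  | succ j h ih => exact (mu_lt d N j hj).trans (ih (by omega))

lemma mem_spec (d N : ℕ) (r : ℝ) : r ∈ spectrum ℝ (massMatrix d N) ↔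
    ∃ v : {α : Fin (d + 1) → ℕ // ∑ j, α j = N} → ℝ, v ≠ 0 ∧ (massMatrix d N).mulVec v = r • v := by
  rw [← Matrix.spectrum_toLin', ← Module.End.hasEigenvalue_iff_mem_spectrum]
  constructor
  · intro h
    obtain ⟨v, hv⟩ := h.exists_hasEigenvector
    exact ⟨v, hv.2, by simpa using hv.apply_eq_smul⟩
  · rintro ⟨v, hv, h⟩
    exact Module.End.hasEigenvalue_of_hasEigenvector (x := v)
      ⟨Module.End.mem_eigenspace_iff.mpr (by simpa using h), hv⟩

/-- Spectrum of the Bernstein mass matrix (Derriennic): for `d ≥ 1`, `N ≥ 0`, the set of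
eigenvalues of `M^N` equals `{ (N!)² / ((N+i+d)!(N−i)!) : 0 ≤ i ≤ N }`; in particular
`M^N` has exactly `N+1` distinct eigenvalues. -/
theorem stmt5 (d N : ℕ) (hd : 1 ≤ d) :
    spectrum ℝ (massMatrix d N)
        = {r : ℝ | ∃ i : ℕ, i ≤ N ∧
            r = (N.factorial : ℝ) ^ 2
              / (((N + i + d).factorial : ℝ) * ((N - i).factorial : ℝ))}
      ∧ (spectrum ℝ (massMatrix d N)).ncard = N + 1 := by

  have h1 : spectrum ℝ (massMatrix d N) = {r : ℝ | ∃ i : ℕ, i ≤ N ∧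
            r = (N.factorial : ℝ) ^ 2
              / (((N + i + d).factorial : ℝ) * ((N - i).factorial : ℝ))} := by
    ext r
    rw [mem_spec]
    constructor
    · rintro ⟨v, hv, h⟩
      exact eig_upper d N r v hv h
    · rintro ⟨i, hi, rfl⟩
      exact eig_lower d N i hd hi
  refine ⟨h1, ?_⟩
  have h2 : spectrum ℝ (massMatrix d N) = (fun i => mu d N i) '' (Finset.range (N+1) : Set ℕ) := by
    rw [h1]
    ext r
    simp only [Set.mem_image, Finset.coe_range, Set.mem_Iio, Nat.lt_succ_iff]
    constructor
    · rintro ⟨i, hi, h⟩; exact ⟨i, hi, h.symm⟩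
    · rintro ⟨i, hi, h⟩; exact ⟨i, hi, h.symm⟩
  rw [h2, Set.ncard_image_of_injOn, Set.ncard_coe_finset, Finset.card_range]
  intro i hi j hj hij
  simp only [Finset.coe_range, Set.mem_Iio, Nat.lt_succ_iff] at hi hj
  rcases lt_trichotomy i j with h | h | h
  · exact absurd hij (mu_anti d N i j h hj).ne'
  · exact h
  · exact absurd hij (mu_anti d N j i h hi).ne
end

section
/- (Lemma A.2: degree reduction scales modes.) Let d ≥ 1, N ≥ 1, 0 ≤ i ≤ N, and 0 ≤ m ≤ N−i. Suppose p : ℝ^d → ℝ is a polynomial function of total degree at most m satisfying ∫_{T_d} p(x) q(x) dx = 0 for every polynomial q of total degree at most m−1, and suppose c (indexed by multi-indices of weight N) and c' (indexed by multi-indices of weight N−i) satisfy p(x) = Σ_{|α|=N} c_α b^N_α(x) = Σ_{|β|=N−i} c'_β b^{N−i}_β(x) for all x ∈ ℝ^d. Then (E^N_{N−i})ᵀ c = (λ^{N−i}_m / λ^N_m) · c', where λ^n_k := (n!)² / ((n+k+d)! · (n−k)!). -/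
open MeasureTheory

/-- Entry `(β, α)` of the one-degree elevation matrix `E^m_{m−1}` (real entries) for
multi-indices over `Fin n`: `(α_j + 1)/m` if `β = α + e_j` for some `j`, `0` otherwise. -/
noncomputable def elevEntryR (n m : ℕ) (β α : Fin n → ℕ) : ℝ :=
  ∑ j, if β = α + Pi.single j 1 then ((α j : ℝ) + 1) / (m : ℝ) else 0

/-- Entry `(β, α)` of the composite elevation matrix
`E^N_{N−i} = E^N_{N−1} E^{N−1}_{N−2} ⋯ E^{N−i+1}_{N−i}` (with `E^N_N` the identity),
for multi-indices over `Fin n` (`β` of weight `N`, `α` of weight `N−i`). -/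
noncomputable def elevComp (n N : ℕ) : ℕ → (Fin n → ℕ) → (Fin n → ℕ) → ℝ
  | 0, β, α => if β = α then 1 else 0
  | i + 1, β, α => ∑ γ ∈ Finset.Nat.antidiagonalTuple n (N - i),
      elevComp n N i β γ * elevEntryR n (N - i) γ α

/-- The `k`-th distinct eigenvalue `λ^n_k = (n!)² / ((n+k+d)!(n−k)!)` of the degree-`n`
Bernstein mass matrix on the unit `d`-simplex. -/
noncomputable def bernEig (d n k : ℕ) : ℝ :=
  (n.factorial : ℝ) ^ 2 / (((n + k + d).factorial : ℝ) * ((n - k).factorial : ℝ))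

theorem s9_beta (r : ℝ) (b : ℕ) : ∀ a : ℕ, ∫ t in (0:ℝ)..r, t ^ a * (r - t) ^ b
    = r ^ (a + b + 1) * (a.factorial * b.factorial) / ((a + b + 1).factorial : ℝ) := by
  induction b with
  | zero =>
    intro a
    simp [integral_pow, Nat.factorial_succ]
    have : (a.factorial : ℝ) ≠ 0 := by positivity
    have : (a : ℝ) + 1 ≠ 0 := by positivity
    field_simp
  | succ b ih =>
    intro a
    have key : ∫ t in (0:ℝ)..r, ((a + 1 : ℝ) * (t ^ a * (r - t) ^ (b + 1))
        - (b + 1 : ℝ) * (t ^ (a + 1) * (r - t) ^ b)) = 0 := by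
      have := intervalIntegral.integral_eq_sub_of_hasDerivAt (a := (0:ℝ)) (b := r)
        (f := fun t : ℝ => t ^ (a + 1) * (r - t) ^ (b + 1))
        (f' := fun t : ℝ => ((a + 1 : ℝ) * (t ^ a * (r - t) ^ (b + 1))
        - (b + 1 : ℝ) * (t ^ (a + 1) * (r - t) ^ b))) (by
          intro x _
          have h1 := (hasDerivAt_pow (a + 1) x)
          have h2 := ((hasDerivAt_id x).const_sub r).pow (b + 1)
          refine (h1.mul h2).congr_deriv ?_
          simp
          ring) (by
          apply Continuous.intervalIntegrable
          fun_prop)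
      rw [this]; simp
    rw [intervalIntegral.integral_sub (by apply Continuous.intervalIntegrable; fun_prop)
      (by apply Continuous.intervalIntegrable; fun_prop),
      intervalIntegral.integral_const_mul, intervalIntegral.integral_const_mul, ih (a + 1)] at key
    have h1 : (a : ℝ) + 1 ≠ 0 := by positivity
    have e : a + 1 + b + 1 = a + (b + 1) + 1 := by ring
    rw [e] at key
    apply mul_left_cancel₀ h1
    rw [sub_eq_zero.mp key]
    push_cast [Nat.factorial_succ]
    ring

def s9S (n : ℕ) (r : ℝ) : Set (Fin n → ℝ) := {x | (∀ i, 0 ≤ x i) ∧ ∑ i, x i ≤ r}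

theorem s9S_compact (n : ℕ) (r : ℝ) : IsCompact (s9S n r) := by
  have hc : IsClosed (s9S n r) := by
    have : s9S n r = (⋂ i, {x | 0 ≤ x i}) ∩ {x | ∑ i, x i ≤ r} := by
      ext x; simp [s9S]
    rw [this]
    refine IsClosed.inter (isClosed_iInter fun i => ?_) ?_
    · exact isClosed_le continuous_const (continuous_apply i)
    · exact isClosed_le (by fun_prop) continuous_const
  refine IsCompact.of_isClosed_subset (isCompact_univ_pi (s := fun _ : Fin n => Set.Icc 0 r)
    (fun _ => isCompact_Icc)) hc ?_
  intro x hx i _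
  exact ⟨hx.1 i, (Finset.single_le_sum (fun j _ => hx.1 j) (Finset.mem_univ i)).trans hx.2⟩

theorem s9_dirichlet (n : ℕ) : ∀ (r : ℝ) (_ : 0 ≤ r) (α : Fin n → ℕ) (a : ℕ),
    ∫ x in s9S n r, (∏ i, x i ^ α i) * (r - ∑ i, x i) ^ a
      = r ^ (∑ i, α i + a + n) * ((∏ i, ((α i).factorial : ℝ)) * a.factorial)
        / ((∑ i, α i + a + n).factorial : ℝ) := by
  induction n with
  | zero =>
    intro r hr α a
    have : s9S 0 r = Set.univ := by ext x; simp [s9S, hr]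
    rw [this]
    simp [Measure.volume_pi_eq_dirac (0 : Fin 0 → ℝ)]
    field_simp
  | succ n ih =>
    intro r hr α a
    have hK := s9S_compact (n + 1) r
    have hcont : Continuous (fun x : Fin (n + 1) → ℝ => (∏ i, x i ^ α i) * (r - ∑ i, x i) ^ a) := by
      fun_prop
    have hint := (hcont.continuousOn.integrableOn_compact hK (μ := volume))
    rw [← integral_indicator hK.measurableSet]
    rw [← integrable_indicator_iff hK.measurableSet] at hint
    set F := (s9S (n + 1) r).indicator
      (fun x : Fin (n + 1) → ℝ => (∏ i, x i ^ α i) * (r - ∑ i, x i) ^ a) with hF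
    have mp := (volume_preserving_piFinSuccAbove (fun _ : Fin (n + 1) => ℝ) 0).symm
    rw [← mp.integral_comp (MeasurableEquiv.measurableEmbedding _)]
    have hint2 := (mp.integrable_comp_emb (MeasurableEquiv.measurableEmbedding _)).2 hint
    rw [Measure.volume_eq_prod] at hint2 ⊢
    refine (integral_prod _ hint2).trans ?_
    simp only [Function.comp]
    have inner : ∀ t : ℝ, (∫ y : Fin n → ℝ,
        F ((MeasurableEquiv.piFinSuccAbove (fun _ : Fin (n + 1) => ℝ) 0).symm (t, y)))
        = (Set.Icc 0 r).indicator (fun t => (((∏ i, ((α (Fin.succ i)).factorial : ℝ)) * a.factorial)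
        / ((∑ i, α (Fin.succ i) + a + n).factorial : ℝ)) *
          (t ^ α 0 * (r - t) ^ (∑ i, α (Fin.succ i) + a + n))) t := by
      intro t
      by_cases ht : t ∈ Set.Icc 0 r
      · rw [Set.indicator_of_mem ht]
        have := ih (r - t) (by linarith [ht.2]) (fun i => α i.succ) a
        have h2 : (fun y : Fin n → ℝ =>
          F ((MeasurableEquiv.piFinSuccAbove (fun _ : Fin (n + 1) => ℝ) 0).symm (t, y)))
          = (s9S n (r - t)).indicator (fun y => t ^ α 0 * ((∏ i, y i ^ α i.succ) * (r - t - ∑ i, y i) ^ a)) := by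
          ext y
          have hm : (MeasurableEquiv.piFinSuccAbove (fun _ : Fin (n + 1) => ℝ) 0).symm (t, y)
            = Fin.cons t y := by
            ext j
            refine Fin.cases ?_ (fun i => ?_) j <;> simp [MeasurableEquiv.piFinSuccAbove]
          rw [hm, hF]
          by_cases hy : y ∈ s9S n (r - t)
          · rw [Set.indicator_of_mem hy, Set.indicator_of_mem]
            · simp [Fin.prod_univ_succ, Fin.sum_univ_succ]
              ring
            · refine ⟨fun i => ?_, ?_⟩
              · refine Fin.cases ?_ (fun j => ?_) i
                · simpa using ht.1
                · simpa using hy.1 j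
              · simp [Fin.sum_univ_succ]; linarith [hy.2]
          · rw [Set.indicator_of_notMem hy, Set.indicator_of_notMem]
            intro h
            apply hy
            refine ⟨fun i => by simpa using h.1 i.succ, ?_⟩
            have := h.2
            simp [Fin.sum_univ_succ] at this
            linarith
        rw [h2, integral_indicator (s9S_compact _ _).measurableSet, integral_const_mul, this]
        ring
      · rw [Set.indicator_of_notMem ht]
        have : ∀ y : Fin n → ℝ, 
          F ((MeasurableEquiv.piFinSuccAbove (fun _ : Fin (n + 1) => ℝ) 0).symm (t, y)) = 0 := by
          intro y
          have hm : (MeasurableEquiv.piFinSuccAbove (fun _ : Fin (n + 1) => ℝ) 0).symm (t, y)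
            = Fin.cons t y := by
            ext j
            refine Fin.cases ?_ (fun i => ?_) j <;> simp [MeasurableEquiv.piFinSuccAbove]
          rw [hm, hF, Set.indicator_of_notMem]
          intro h
          apply ht
          have h0 : 0 ≤ t := by simpa using h.1 0
          have := h.2
          simp [Fin.sum_univ_succ] at this
          have h3 : 0 ≤ ∑ i, y i := Finset.sum_nonneg fun i _ => by simpa using h.1 i.succ
          exact ⟨h0, by linarith⟩
        simp only [this, integral_zero]
    simp_rw [inner]
    rw [integral_indicator measurableSet_Icc, integral_Icc_eq_integral_Ioc,
      ← intervalIntegral.integral_of_le hr, intervalIntegral.integral_const_mul, s9_beta]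
    have e : α 0 + (∑ i, α (Fin.succ i) + a + n) + 1 = ∑ i, α i + a + (n + 1) := by
      rw [Fin.sum_univ_succ]; ring
    rw [e, Fin.prod_univ_succ]
    field_simp

section

open MvPolynomial in
noncomputable def s9s (d : ℕ) : MvPolynomial (Fin (d + 1)) ℝ := ∑ j, X j

open MvPolynomial in
noncomputable def s9D (d : ℕ) (F : MvPolynomial (Fin (d + 1)) ℝ) : MvPolynomial (Fin (d + 1)) ℝ :=
  ∑ j, pderiv j (X j * pderiv j F)

noncomputable def s9L (d : ℕ) : MvPolynomial (Fin (d + 1)) ℝ →ₗ[ℝ] ℝ :=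
  (MvPolynomial.basisMonomials (Fin (d + 1)) ℝ).constr ℝ (fun α => ∏ j, ((α j).factorial : ℝ))

open MvPolynomial

theorem s9L_monomial (d : ℕ) (α : Fin (d + 1) →₀ ℕ) (c : ℝ) :
    s9L d (monomial α c) = c * ∏ j, ((α j).factorial : ℝ) := by
  have h := (MvPolynomial.basisMonomials (Fin (d + 1)) ℝ).constr_basis ℝ
    (fun α => ∏ j, ((α j).factorial : ℝ)) α
  have : monomial α c = c • monomial α (1 : ℝ) := by simp [smul_monomial]
  rw [this, map_smul, smul_eq_mul]
  congr 1

theorem s9_prod_fact (d : ℕ) (α : Fin (d + 1) →₀ ℕ) (j : Fin (d + 1)) :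
    ∏ k, (((α + Finsupp.single j 1 : Fin (d + 1) →₀ ℕ) k).factorial : ℝ)
      = (α j + 1) * ∏ k, ((α k).factorial : ℝ) := by
  rw [← Finset.mul_prod_erase _ _ (Finset.mem_univ j),
    ← Finset.mul_prod_erase _ (fun k => ((α k).factorial : ℝ)) (Finset.mem_univ j)]
  have : ∏ k ∈ Finset.univ.erase j, (((α + Finsupp.single j 1 : Fin (d + 1) →₀ ℕ) k).factorial : ℝ)
      = ∏ k ∈ Finset.univ.erase j, ((α k).factorial : ℝ) := by
    apply Finset.prod_congr rfl
    intro k hk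
    have : k ≠ j := (Finset.mem_erase.1 hk).1
    simp [Finsupp.single_apply, this.symm]
  rw [this]
  simp [Nat.factorial_succ]
  ring

theorem s9L_ibp (d : ℕ) (j : Fin (d + 1)) (F : MvPolynomial (Fin (d + 1)) ℝ) :
    s9L d (pderiv j (X j * F)) = s9L d (X j * F) := by
  induction F using MvPolynomial.induction_on' with
  | monomial α c =>
    have : X j * monomial α c = monomial (α + Finsupp.single j 1) c := by
      rw [add_comm α, monomial_single_add]; simp
    rw [this, pderiv_monomial, s9L_monomial, s9L_monomial, s9_prod_fact]
    simp
    ring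
  | add p q hp hq => simp only [mul_add, map_add, hp, hq]

theorem s9L_adj (d : ℕ) (F G : MvPolynomial (Fin (d + 1)) ℝ) (n : ℕ) (hG : G.IsHomogeneous n) :
    s9L d (s9D d F * G) = s9L d (F * (s9s d * G)) - (2 * n + (d + 1)) * s9L d (F * G)
      + s9L d (F * s9D d G) := by
  have h : ∀ j, s9L d (pderiv j (X j * pderiv j F) * G)
      = s9L d (F * (X j * G)) - 2 * s9L d (F * (X j * pderiv j G)) - s9L d (F * G)
        + s9L d (F * pderiv j (X j * pderiv j G)) := by
    intro j
    have h1 := s9L_ibp d j (pderiv j F * G)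
    have h2 := s9L_ibp d j (F * G)
    have h3 := s9L_ibp d j (F * pderiv j G)
    have e1 : pderiv j (X j * (pderiv j F * G)) = pderiv j (X j * pderiv j F) * G
      + X j * pderiv j F * pderiv j G := by
      rw [← mul_assoc, pderiv_mul]
    have e2 : pderiv j (X j * (F * G)) = F * G + X j * (pderiv j F * G) + F * (X j * pderiv j G) := by
      simp only [pderiv_mul, pderiv_X_self]; ring
    have e3 : pderiv j (X j * (F * pderiv j G)) = X j * pderiv j F * pderiv j G +
      F * pderiv j (X j * pderiv j G) := by
      simp only [pderiv_mul, pderiv_X_self]; ring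
    rw [e1, map_add] at h1
    rw [e2, map_add, map_add] at h2
    rw [e3, map_add] at h3
    have e4 : X j * (F * G) = F * (X j * G) := by ring
    have e5 : X j * (F * pderiv j G) = F * (X j * pderiv j G) := by ring
    rw [e4] at h2
    rw [e5] at h3
    linarith
  have euler := hG.sum_X_mul_pderiv
  have h5 : ∑ j, s9L d (F * (X j * pderiv j G)) = n * s9L d (F * G) := by
    rw [← map_sum, ← Finset.mul_sum, euler, mul_smul_comm, map_nsmul]
    simp
  simp only [s9D, s9s, Finset.sum_mul, Finset.mul_sum, map_sum, h, Finset.sum_add_distrib,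
    Finset.sum_sub_distrib]
  rw [← Finset.mul_sum, h5]
  simp
  ring

theorem s9D_s (d : ℕ) (F : MvPolynomial (Fin (d + 1)) ℝ) (n : ℕ) (hF : F.IsHomogeneous n) :
    s9D d (s9s d * F) = s9s d * s9D d F + C ((2 * n + d + 1 : ℕ) : ℝ) * F := by
  have hs : ∀ j, pderiv j (s9s d) = 1 := by
    intro j
    simp [s9s, pderiv_X, Pi.single_apply]
  have h : ∀ j, pderiv j (X j * pderiv j (s9s d * F)) = s9s d * pderiv j (X j * pderiv j F)
      + 2 * (X j * pderiv j F) + F := by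
    intro j
    simp only [pderiv_mul, hs, pderiv_X_self, map_add, pderiv_one]
    ring
  simp only [s9D, h, Finset.sum_add_distrib]
  rw [← Finset.mul_sum, ← Finset.mul_sum, hF.sum_X_mul_pderiv]
  simp only [Finset.sum_const, Finset.card_univ, Fintype.card_fin, nsmul_eq_mul, map_natCast]
  push_cast
  ring

theorem s9s_hom (d : ℕ) : (s9s d).IsHomogeneous 1 :=
  IsHomogeneous.sum _ _ _ fun j _ => isHomogeneous_X ℝ j

theorem s9D_hom (d : ℕ) (F : MvPolynomial (Fin (d + 1)) ℝ) (n : ℕ) (hF : F.IsHomogeneous n) :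
    (s9D d F).IsHomogeneous (n - 1) := by
  apply IsHomogeneous.sum
  intro j _
  have h := ((isHomogeneous_X ℝ j).mul (hF.pderiv (i := j))).pderiv (i := j)
  rwa [Nat.add_sub_cancel_left] at h

theorem s9D_pow (d : ℕ) (Q : MvPolynomial (Fin (d + 1)) ℝ) (m : ℕ) (hQ : Q.IsHomogeneous m)
    (h0 : s9D d Q = 0) (k : ℕ) :
    s9D d (s9s d ^ (k + 1) * Q) = C (((k + 1) * (k + 1 + 2 * m + d) : ℕ) : ℝ) * (s9s d ^ k * Q) := by
  induction k with
  | zero =>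
    have := s9D_s d Q m hQ
    rw [h0] at this
    simp only [zero_add, pow_one, this, pow_zero, one_mul, mul_zero]
    congr 3
    ring
  | succ k ih =>
    have hh : (s9s d ^ (k + 1) * Q).IsHomogeneous (k + 1 + m) := by
      simpa using ((s9s_hom d).pow (k + 1)).mul hQ
    have := s9D_s d _ _ hh
    rw [pow_succ' _ (k + 1), mul_assoc, this, ih]
    simp only [map_natCast]
    push_cast
    ring

theorem s9_bary_sum (d : ℕ) (x : Fin d → ℝ) : ∑ j, bary d x j = 1 := by
  simp [bary, Fin.sum_univ_castSucc]

theorem s9_eval_s (d : ℕ) (x : Fin d → ℝ) : eval (bary d x) (s9s d) = 1 := by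
  simp [s9s, s9_bary_sum]

theorem s9_cont (d : ℕ) (F : MvPolynomial (Fin (d + 1)) ℝ) :
    Continuous fun x => eval (bary d x) F := by
  have hb : Continuous (bary d) := by
    refine continuous_pi fun j => ?_
    refine Fin.lastCases ?_ (fun i => ?_) j
    · simp only [bary, Fin.snoc_last]; fun_prop
    · simp only [bary, Fin.snoc_castSucc]; fun_prop
  exact (MvPolynomial.continuous_eval F).comp hb

theorem s9_simplex (d : ℕ) : unitSimplex d = s9S d 1 := rfl

theorem s9_L_int (d n : ℕ) (F : MvPolynomial (Fin (d + 1)) ℝ) (hF : F.IsHomogeneous n) :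
    ∫ x in unitSimplex d, eval (bary d x) F = s9L d F / ((n + d).factorial : ℝ) := by
  have hi : ∀ G : MvPolynomial (Fin (d + 1)) ℝ,
      IntegrableOn (fun x => eval (bary d x) G) (unitSimplex d) volume := fun G =>
    (s9_cont d G).continuousOn.integrableOn_compact (s9S_compact d 1)
  have key : ∀ α ∈ F.support, ∫ x in unitSimplex d, eval (bary d x) (monomial α (F.coeff α))
      = s9L d (monomial α (F.coeff α)) / ((n + d).factorial : ℝ) := by
    intro α hα
    have hdeg : ∑ j, α j = n := by
      have := hF.degree_eq_sum_deg_support hα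
      rw [this]
      exact (Finset.sum_subset (Finset.subset_univ _) (by simp)).symm
    rw [s9L_monomial]
    have h1 := s9_dirichlet d 1 zero_le_one (fun i => α i.castSucc) (α (Fin.last d))
    have e : ∀ x, eval (bary d x) (monomial α (F.coeff α)) = F.coeff α *
      ((∏ i, x i ^ α (Fin.castSucc i)) * (1 - ∑ i, x i) ^ (α (Fin.last d))) := by
      intro x
      rw [eval_monomial, Finsupp.prod_fintype _ _ (by simp)]
      simp [Fin.prod_univ_castSucc, bary]
    simp_rw [e]
    rw [integral_const_mul, s9_simplex, h1]
    rw [Fin.sum_univ_castSucc] at hdeg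
    rw [hdeg, Fin.prod_univ_castSucc]
    simp
    ring
  conv_lhs => rw [F.as_sum]
  conv_rhs => rw [F.as_sum]
  simp only [map_sum]
  rw [integral_finsetSum _ (fun α _ => hi _), Finset.sum_div]
  exact Finset.sum_congr rfl key

theorem s9_uniq (d n : ℕ) (F : MvPolynomial (Fin (d + 1)) ℝ) (hF : F.IsHomogeneous n)
    (h : ∀ x, eval (bary d x) F = 0) : F = 0 := by
  have hs : s9s d ≠ 0 := by
    intro h0
    have := s9_eval_s d 0
    rw [h0] at this
    simp at this
  have : s9s d * F = 0 := by
    apply MvPolynomial.funext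
    intro y
    rw [map_mul, map_zero]
    by_cases hy : eval y (s9s d) = 0
    · simp [hy]
    · set t := eval y (s9s d) with ht
      have hsum : ∑ j, y j = t := by simp [ht, s9s]
      have hb : y = fun j => t * bary d (fun i => t⁻¹ * y i.castSucc) j := by
        ext j
        refine Fin.lastCases ?_ (fun i => ?_) j
        · rw [Fin.sum_univ_castSucc] at hsum
          simp only [bary, Fin.snoc_last]
          rw [← Finset.mul_sum, mul_sub, ← mul_assoc, mul_inv_cancel₀ hy]
          linarith
        · simp only [bary, Fin.snoc_castSucc]
          field_simp
      have := h (fun i => t⁻¹ * y i.castSucc)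
      have e : eval y F = t ^ n * eval (bary d (fun i => t⁻¹ * y i.castSucc)) F := by
        conv_lhs => rw [hb]
        rw [eval_eq', eval_eq', Finset.mul_sum]
        refine Finset.sum_congr rfl fun α hα => ?_
        have h6 : ∑ j, α j = n := by
          rw [hF.degree_eq_sum_deg_support hα]
          exact (Finset.sum_subset (Finset.subset_univ _) (by simp)).symm
        simp only [mul_pow, Finset.prod_mul_distrib, Finset.prod_pow_eq_pow_sum, h6]
        ring
      rw [e, this]; simp
  exact (mul_eq_zero.1 this).resolve_left hs

/-- barycentric coordinate polynomials -/
noncomputable def s9b (d : ℕ) : Fin (d + 1) → MvPolynomial (Fin d) ℝ :=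
  Fin.snoc X (1 - ∑ i, X i)

theorem s9b_eval (d : ℕ) (x : Fin d → ℝ) (F : MvPolynomial (Fin (d + 1)) ℝ) :
    eval x (aeval (s9b d) F) = eval (bary d x) F := by
  have : bary d x = fun j => eval x (s9b d j) := by
    ext j
    refine Fin.lastCases ?_ (fun i => ?_) j
    · simp [bary, s9b]
    · simp [bary, s9b]
  rw [this]
  induction F using MvPolynomial.induction_on with
  | C a => simp
  | add p q hp hq => rw [map_add, map_add, map_add, hp, hq]
  | mul_X p j hp => rw [map_mul, map_mul, map_mul, hp]; simp

theorem s9b_deg (d : ℕ) (F : MvPolynomial (Fin (d + 1)) ℝ) :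
    (aeval (s9b d) F).totalDegree ≤ F.totalDegree := by
  have h1 : ∀ j, (s9b d j).totalDegree ≤ 1 := by
    intro j
    refine Fin.lastCases ?_ (fun i => ?_) j
    · simp only [s9b, Fin.snoc_last]
      refine (totalDegree_sub _ _).trans (max_le (by simp) ?_)
      exact totalDegree_finsetSum_le fun i _ => by simp
    · simp [s9b]
  rw [aeval_def, eval₂_eq]
  refine totalDegree_finsetSum_le fun α hα => ?_
  refine (totalDegree_mul _ _).trans ?_
  have h2 : (algebraMap ℝ (MvPolynomial (Fin d) ℝ) (coeff α F)).totalDegree = 0 := by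
    rw [algebraMap_eq]; simp
  rw [h2, zero_add]
  refine (totalDegree_finsetProd _ _).trans ?_
  refine le_trans ?_ (le_totalDegree hα)
  rw [Finsupp.sum]
  refine Finset.sum_le_sum fun j _ => ?_
  refine (totalDegree_pow _ _).trans ?_
  exact (Nat.mul_le_mul_left _ (h1 j)).trans (by simp)

theorem s9_pos (d n : ℕ) (F : MvPolynomial (Fin (d + 1)) ℝ) (hF : F.IsHomogeneous n)
    (h : ∫ x in unitSimplex d, eval (bary d x) F * eval (bary d x) F = 0) : F = 0 := by
  apply s9_uniq d n F hF
  have hi : IntegrableOn (fun x => eval (bary d x) F * eval (bary d x) F) (unitSimplex d) volume :=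
    ((s9_cont d F).mul (s9_cont d F)).continuousOn.integrableOn_compact (s9S_compact d 1)
  rw [setIntegral_eq_zero_iff_of_nonneg_ae
    (Filter.Eventually.of_forall fun x => mul_self_nonneg _) hi] at h
  set U : Set (Fin d → ℝ) := Set.pi Set.univ (fun _ => Set.Ioo 0 (1 / (d + 1 : ℝ))) with hU
  have hUo : IsOpen U := isOpen_set_pi Set.finite_univ fun _ _ => isOpen_Ioo
  have hsub : U ⊆ unitSimplex d := by
    intro x hx
    refine ⟨fun i => (hx i trivial).1.le, ?_⟩
    calc ∑ i, x i ≤ ∑ i : Fin d, 1 / (d + 1 : ℝ) := Finset.sum_le_sum fun i _ => (hx i trivial).2.le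
      _ ≤ 1 := by
        simp
        rw [← div_eq_mul_inv, div_le_one (by positivity)]
        linarith
  have hae := ae_mono (Measure.restrict_mono hsub (le_refl (volume : Measure (Fin d → ℝ)))) h
  have heq := Measure.eqOn_open_of_ae_eq hae hUo
    ((s9_cont d F).mul (s9_cont d F)).continuousOn continuousOn_const
  have hz : aeval (s9b d) F = 0 := by
    apply MvPolynomial.funext_set (fun _ => Set.Ioo 0 (1 / (d + 1 : ℝ)))
      (fun _ => Set.Ioo_infinite (by positivity))
    intro x hx
    have := heq hx
    rw [s9b_eval, map_zero]
    simpa using this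
  intro x
  rw [← s9b_eval, hz, map_zero]

theorem s9_DQ (d m : ℕ) (Q : MvPolynomial (Fin (d + 1)) ℝ) (hQ : Q.IsHomogeneous m)
    (horth : ∀ q : MvPolynomial (Fin d) ℝ, q.totalDegree < m →
      ∫ x in unitSimplex d, eval (bary d x) Q * MvPolynomial.eval x q = 0) : s9D d Q = 0 := by
  rcases Nat.eq_zero_or_pos m with rfl | hm
  · rw [← totalDegree_zero_iff_isHomogeneous, totalDegree_eq_zero_iff_eq_C] at hQ
    rw [hQ]
    simp [s9D]
  have hG : ∀ (G : MvPolynomial (Fin (d + 1)) ℝ) (k : ℕ), G.IsHomogeneous k → k < m →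
      (∫ x in unitSimplex d, eval (bary d x) Q * eval (bary d x) G = 0) ∧ s9L d (Q * G) = 0 := by
    intro G k hk hkm
    have h1 := horth (aeval (s9b d) G)
      (((s9b_deg d G).trans hk.totalDegree_le).trans_lt hkm)
    simp only [s9b_eval] at h1
    refine ⟨h1, ?_⟩
    have h2 := s9_L_int d _ _ (hQ.mul hk)
    simp only [map_mul] at h2
    rw [h1] at h2
    rcases div_eq_zero_iff.1 h2.symm with h3 | h3
    · exact h3
    · exact absurd h3 (by positivity)
  have hD := s9D_hom d Q m hQ
  apply s9_pos d _ _ hD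
  have h4 := s9_L_int d _ _ (hD.mul hD)
  simp only [map_mul] at h4
  rw [h4, s9L_adj d Q _ _ hD, (hG _ _ hD (by omega)).2,
    (hG _ _ (s9D_hom d _ _ hD) (by omega)).2]
  have h5 := s9_L_int d _ _ (hQ.mul ((s9s_hom d).mul hD))
  simp only [map_mul, s9_eval_s, one_mul] at h5
  rw [(hG _ _ hD (by omega)).1] at h5
  rcases div_eq_zero_iff.1 h5.symm with h3 | h3
  · rw [h3]; simp
  · exact absurd h3 (by positivity)

theorem s9_homog (d m : ℕ) (P : MvPolynomial (Fin d) ℝ) (hP : P.totalDegree ≤ m) :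
    ∃ Q : MvPolynomial (Fin (d + 1)) ℝ, Q.IsHomogeneous m ∧
      ∀ x, eval (bary d x) Q = eval x P := by
  refine ⟨∑ k ∈ Finset.range (m + 1),
    s9s d ^ (m - k) * rename Fin.castSucc (homogeneousComponent k P), ?_, ?_⟩
  · apply IsHomogeneous.sum
    intro k hk
    have h := ((s9s_hom d).pow (m - k)).mul
      ((homogeneousComponent_isHomogeneous k P).rename_isHomogeneous (f := Fin.castSucc))
    have e : 1 * (m - k) + k = m := by
      have := Finset.mem_range.1 hk
      omega
    rwa [e] at h
  · intro x
    have hb : bary d x ∘ Fin.castSucc = x := by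
      ext i; simp [bary]
    simp only [map_sum, map_mul, map_pow, s9_eval_s, one_pow, one_mul, eval_rename, hb]
    rw [← map_sum]
    congr 1
    conv_rhs => rw [← sum_homogeneousComponent P]
    refine (Finset.sum_subset ?_ ?_).symm
    · intro k hk
      simp only [Finset.mem_range] at *
      omega
    · intro k _ hk
      apply homogeneousComponent_eq_zero
      simp only [Finset.mem_range] at hk
      omega

theorem s9_coef (d m N : ℕ) (hm : m ≤ N) (Q : MvPolynomial (Fin (d + 1)) ℝ)
    (hQ : Q.IsHomogeneous m) (c : (Fin (d + 1) → ℕ) → ℝ)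
    (hc : ∀ x, eval (bary d x) Q
      = ∑ α ∈ Finset.Nat.antidiagonalTuple (d + 1) N, c α * bernFn d N α x)
    (β : Fin (d + 1) →₀ ℕ) (hβ : ∑ j, β j = N) :
    c β = coeff β (s9s d ^ (N - m) * Q) * (∏ j, ((β j).factorial : ℝ)) / (N.factorial : ℝ) := by
  set G : MvPolynomial (Fin (d + 1)) ℝ := ∑ α ∈ Finset.Nat.antidiagonalTuple (d + 1) N,
    monomial (Finsupp.equivFunOnFinite.symm α)
      (c α * ((N.factorial : ℝ) / ∏ j, ((α j).factorial : ℝ))) with hG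
  have hGh : G.IsHomogeneous N := by
    apply IsHomogeneous.sum
    intro α hα
    apply isHomogeneous_monomial
    rw [Finset.Nat.mem_antidiagonalTuple] at hα
    rw [Finsupp.degree_eq_sum]
    simpa using hα
  have hsQ : (s9s d ^ (N - m) * Q).IsHomogeneous N := by
    have := ((s9s_hom d).pow (N - m)).mul hQ
    have e : 1 * (N - m) + m = N := by omega
    rwa [e] at this
  have hz := s9_uniq d N _ (hsQ.sub hGh) (by
    intro x
    rw [map_sub, map_mul, map_pow, s9_eval_s, one_pow, one_mul, hc x, hG, map_sum, sub_eq_zero]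
    refine Finset.sum_congr rfl fun α _ => ?_
    rw [eval_monomial, Finsupp.prod_fintype _ _ (by simp), bernFn]
    simp
    ring)
  rw [sub_eq_zero.1 hz, hG, coeff_sum, Finset.sum_eq_single (β : Fin (d + 1) → ℕ)]
  · have h0 : (∏ j, ((β j).factorial : ℝ)) ≠ 0 :=
      Finset.prod_ne_zero_iff.2 fun j _ => by positivity
    have h1 : (N.factorial : ℝ) ≠ 0 := by positivity
    rw [coeff_monomial, if_pos (by ext; simp)]
    field_simp
  · intro α _ hα
    rw [coeff_monomial, if_neg]
    intro h
    apply hα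
    rw [← h]
    ext; simp
  · intro h
    rw [Finset.Nat.mem_antidiagonalTuple] at h
    exact absurd hβ h

theorem s9_coeff_D (d : ℕ) (F : MvPolynomial (Fin (d + 1)) ℝ) (β : Fin (d + 1) →₀ ℕ) :
    coeff β (s9D d F) = ∑ j, ((β j : ℝ) + 1) ^ 2 * coeff (β + Finsupp.single j 1) F := by
  rw [s9D, coeff_sum]
  refine Finset.sum_congr rfl fun j _ => ?_
  rw [coeff_pderiv, add_comm β, coeff_X_mul, coeff_pderiv, add_comm β]
  push_cast
  ring

theorem s9_elev (d n : ℕ) (β : Fin (d + 1) →₀ ℕ) (hβ : ∑ j, β j = n)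
    (R : (Fin (d + 1) → ℕ) → ℝ) :
    ∑ γ ∈ Finset.Nat.antidiagonalTuple (d + 1) (n + 1), elevEntryR (d + 1) (n + 1) γ β * R γ
      = ∑ j, ((β j : ℝ) + 1) / ((n + 1 : ℕ) : ℝ)
        * R ((β + Finsupp.single j 1 : Fin (d + 1) →₀ ℕ)) := by
  simp only [elevEntryR, Finset.sum_mul]
  rw [Finset.sum_comm]
  refine Finset.sum_congr rfl fun j _ => ?_
  have e : (⇑(β + Finsupp.single j 1 : Fin (d + 1) →₀ ℕ) : Fin (d + 1) → ℕ) = ⇑β + Pi.single j 1 := by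
    rw [Finsupp.coe_add, Finsupp.single_eq_pi_single]
  rw [e, Finset.sum_eq_single (⇑β + Pi.single j 1 : Fin (d + 1) → ℕ)]
  · simp
  · intro γ _ hγ
    rw [if_neg hγ, zero_mul]
  · intro h
    exfalso
    apply h
    rw [Finset.Nat.mem_antidiagonalTuple]
    simp [Finset.sum_add_distrib, hβ]

theorem s9_main (d N m : ℕ) (c : (Fin (d + 1) → ℕ) → ℝ) (Q : MvPolynomial (Fin (d + 1)) ℝ)
    (hQ : Q.IsHomogeneous m) (hD : s9D d Q = 0)
    (hc : ∀ β : Fin (d + 1) →₀ ℕ, ∑ j, β j = N → c β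
      = coeff β (s9s d ^ (N - m) * Q) * (∏ j, ((β j).factorial : ℝ)) / (N.factorial : ℝ))
    (k : ℕ) : k + m ≤ N → ∀ β : Fin (d + 1) →₀ ℕ, ∑ j, β j = N - k →
      ∑ α ∈ Finset.Nat.antidiagonalTuple (d + 1) N, elevComp (d + 1) N k α β * c α
        = (bernEig d (N - k) m / bernEig d N m) *
          (coeff β (s9s d ^ (N - k - m) * Q) * (∏ j, ((β j).factorial : ℝ))
            / ((N - k).factorial : ℝ)) := by
  have hpos : ∀ n, bernEig d n m ≠ 0 := by
    intro n; unfold bernEig; positivity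
  induction k with
  | zero =>
    intro hk β hβ
    have h1 : bernEig d (N - 0) m / bernEig d N m = 1 := div_self (hpos N)
    rw [h1, one_mul, Nat.sub_zero, ← hc β hβ]
    rw [Finset.sum_eq_single (β : Fin (d + 1) → ℕ)]
    · simp [elevComp]
    · intro α _ hα
      simp [elevComp, hα]
    · intro h
      rw [Finset.Nat.mem_antidiagonalTuple] at h
      exact absurd hβ h
  | succ k ih =>
    intro hk β hβ
    obtain ⟨t, rfl⟩ : ∃ t, N = t + m + 1 + k := ⟨N - m - 1 - k, by omega⟩
    have ih := ih (by omega)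
    have e1 : t + m + 1 + k - k = (t + m) + 1 := by omega
    have e2 : t + m + 1 + k - (k + 1) = t + m := by omega
    have e3 : t + m + 1 - m = t + 1 := by omega
    have e4 : t + m - m = t := by omega
    rw [e1, e3] at ih
    rw [e2] at hβ
    rw [e2, e4]
    simp only [elevComp, e1]
    have step : ∑ α ∈ Finset.Nat.antidiagonalTuple (d + 1) (t + m + 1 + k),
        (∑ γ ∈ Finset.Nat.antidiagonalTuple (d + 1) (t + m + 1),
          elevComp (d + 1) (t + m + 1 + k) k α γ * elevEntryR (d + 1) (t + m + 1) γ β) * c α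
        = ∑ γ ∈ Finset.Nat.antidiagonalTuple (d + 1) (t + m + 1),
          elevEntryR (d + 1) (t + m + 1) γ β *
            ∑ α ∈ Finset.Nat.antidiagonalTuple (d + 1) (t + m + 1 + k),
              elevComp (d + 1) (t + m + 1 + k) k α γ * c α := by
      simp only [Finset.sum_mul, Finset.mul_sum]
      rw [Finset.sum_comm]
      refine Finset.sum_congr rfl fun γ _ => Finset.sum_congr rfl fun α _ => ?_
      ring
    rw [step, s9_elev d (t + m) β hβ]
    have h2 : ∀ j : Fin (d + 1), ∑ l, (β + Finsupp.single j 1 : Fin (d + 1) →₀ ℕ) l = t + m + 1 := by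
      intro j
      simp [Finset.sum_add_distrib, hβ, Finsupp.single_eq_pi_single]
    simp only [fun j => ih _ (h2 j), s9_prod_fact]
    have h3 := s9_coeff_D d (s9s d ^ (t + 1) * Q) β
    rw [s9D_pow d Q m hQ hD t, coeff_C_mul] at h3
    have h4 : ∀ j, ((β j : ℝ) + 1) / ((t + m + 1 : ℕ) : ℝ) *
        (bernEig d (t + m + 1) m / bernEig d (t + m + 1 + k) m *
        (coeff (β + Finsupp.single j 1) (s9s d ^ (t + 1) * Q) *
          (((β j : ℝ) + 1) * ∏ l, ((β l).factorial : ℝ)) / ((t + m + 1).factorial : ℝ)))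
        = (bernEig d (t + m + 1) m / bernEig d (t + m + 1 + k) m * (∏ l, ((β l).factorial : ℝ))
          / (((t + m + 1 : ℕ) : ℝ) * ((t + m + 1).factorial : ℝ))) *
          (((β j : ℝ) + 1) ^ 2 * coeff (β + Finsupp.single j 1) (s9s d ^ (t + 1) * Q)) := by
      intro j
      field_simp
    simp only [h4]
    rw [← Finset.mul_sum, ← h3]
    have h5 := hpos (t + m + 1 + k)
    have h6 : bernEig d (t + m + 1) m * ((t + 1) * (t + 1 + 2 * m + d) : ℕ)
        / (((t + m + 1 : ℕ) : ℝ) * ((t + m + 1).factorial : ℝ))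
        = bernEig d (t + m) m / ((t + m).factorial : ℝ) := by
      unfold bernEig
      rw [e3, e4]
      have e5 : t + m + 1 + m + d = (t + m + m + d) + 1 := by ring
      rw [e5, Nat.factorial_succ (t + m + m + d), Nat.factorial_succ t, Nat.factorial_succ (t + m)]
      push_cast
      field_simp
      ring
    calc _ = (bernEig d (t + m + 1) m * ((t + 1) * (t + 1 + 2 * m + d) : ℕ)
        / (((t + m + 1 : ℕ) : ℝ) * ((t + m + 1).factorial : ℝ))) * ((∏ l, ((β l).factorial : ℝ))
          * coeff β (s9s d ^ t * Q) / bernEig d (t + m + 1 + k) m) := by ring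
      _ = _ := by rw [h6]; ring

end

/-- (Lemma A.2: degree reduction scales modes.)  Let `d ≥ 1`, `N ≥ 1`, `0 ≤ i ≤ N`,
`0 ≤ m ≤ N−i`.  If `p : ℝ^d → ℝ` is a polynomial function of total degree at most `m`,
`L²(T_d)`-orthogonal to every polynomial of total degree at most `m−1` (i.e. `< m`), and
`c`, `c'` are Bernstein coefficient vectors for `p` of degrees `N` and `N−i`, then
`(E^N_{N−i})ᵀ c = (λ^{N−i}_m / λ^N_m) · c'`. -/
theorem stmt9 (d N i m : ℕ) (hd : 1 ≤ d) (hN : 1 ≤ N) (hi : i ≤ N) (hm : m ≤ N - i)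
    (p : (Fin d → ℝ) → ℝ)
    (hp : ∃ P : MvPolynomial (Fin d) ℝ, P.totalDegree ≤ m ∧
      ∀ x, MvPolynomial.eval x P = p x)
    (horth : ∀ q : MvPolynomial (Fin d) ℝ, q.totalDegree < m →
      ∫ x in unitSimplex d, p x * MvPolynomial.eval x q = 0)
    (c c' : (Fin (d + 1) → ℕ) → ℝ)
    (hc : ∀ x, p x = ∑ α ∈ Finset.Nat.antidiagonalTuple (d + 1) N, c α * bernFn d N α x)
    (hc' : ∀ x, p x = ∑ β ∈ Finset.Nat.antidiagonalTuple (d + 1) (N - i),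
      c' β * bernFn d (N - i) β x) :
    ∀ β : Fin (d + 1) → ℕ, (∑ k, β k) = N - i →
      ∑ α ∈ Finset.Nat.antidiagonalTuple (d + 1) N, elevComp (d + 1) N i α β * c α
        = (bernEig d (N - i) m / bernEig d N m) * c' β := by

  obtain ⟨P, hP, hPp⟩ := hp
  obtain ⟨Q, hQ, hQP⟩ := s9_homog d m P hP
  have hQp : ∀ x, p x = MvPolynomial.eval (bary d x) Q := fun x => by rw [hQP, hPp]
  simp only [hQp] at hc hc' horth
  have hD := s9_DQ d m Q hQ horth
  intro β hβ
  have h1 := s9_main d N m c Q hQ hD (fun γ hγ => s9_coef d m N (by omega) Q hQ c hc γ hγ) i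
    (by omega) (Finsupp.equivFunOnFinite.symm β) (by simpa using hβ)
  rw [← s9_coef d m (N - i) hm Q hQ c' hc' (Finsupp.equivFunOnFinite.symm β)
    (by simpa using hβ)] at h1
  simpa using h1
end

section
/- Spectrum of reduction composed with elevation: let d ≥ 1 and N ≥ 0. The set of eigenvalues of the rational matrix (E^{N+1}_N)ᵀ E^{N+1}_N (indexed by multi-indices over Fin (d+1) of weight N) equals { (N+1−k)(N+1+k+d) / (N+1)² : 0 ≤ k ≤ N }. -/
/-- Entry `(β, α)` of the one-degree elevation matrix `E^m_{m−1}` for multi-indices over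
`Fin n`: it equals `(α_j + 1)/m` if `β = α + e_j` for some `j`, and `0` otherwise. -/
def elevEntry (n m : ℕ) (β α : Fin n → ℕ) : ℚ :=
  ∑ j, if β = α + Pi.single j 1 then ((α j : ℚ) + 1) / (m : ℚ) else 0

/-- The rational matrix `(E^{N+1}_N)ᵀ E^{N+1}_N`, indexed by multi-indices over
`Fin (d+1)` of weight `N`. -/
noncomputable def redElev (d N : ℕ) :
    Matrix {β : Fin (d + 1) → ℕ // ∑ j, β j = N}
           {β : Fin (d + 1) → ℕ // ∑ j, β j = N} ℚ :=
  fun β β' => ∑ γ ∈ Finset.Nat.antidiagonalTuple (d + 1) (N + 1),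
    elevEntry (d + 1) (N + 1) γ β.1 * elevEntry (d + 1) (N + 1) γ β'.1

namespace RedElevAux

/-- Unscaled elevation. -/
def S {n : ℕ} (c : (Fin n → ℕ) → ℚ) (β : Fin n → ℕ) : ℚ :=
  ∑ j, (β j : ℚ) * c (β - Pi.single j 1)

/-- Unscaled reduction. -/
def L {n : ℕ} (c : (Fin n → ℕ) → ℚ) (α : Fin n → ℕ) : ℚ :=
  ∑ j, ((α j : ℚ) + 1) * c (α + Pi.single j 1)

lemma weight_add {n : ℕ} (α : Fin n → ℕ) (j : Fin n) :
    ∑ i, (α + Pi.single j 1 : Fin n → ℕ) i = ∑ i, α i + 1 := by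
  simp [Finset.sum_add_distrib]

lemma sub_add_single {n : ℕ} (α : Fin n → ℕ) (j : Fin n) (h : α j ≠ 0) :
    α - Pi.single j 1 + Pi.single j 1 = α := by
  funext i
  by_cases hi : i = j
  · subst hi; simp; omega
  · simp [hi]

lemma weight_sub {n N : ℕ} (α : Fin n → ℕ) (j : Fin n) (h : α j ≠ 0)
    (hα : ∑ i, α i = N + 1) : ∑ i, (α - Pi.single j 1 : Fin n → ℕ) i = N := by
  have := weight_add (α - Pi.single j 1 : Fin n → ℕ) j
  rw [sub_add_single α j h] at this
  omega

lemma comm {n : ℕ} (c : (Fin n → ℕ) → ℚ) (α : Fin n → ℕ) :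
    L (S c) α = S (L c) α + (2 * ((∑ i, α i : ℕ) : ℚ) + n) * c α := by
  have key : ∀ i j : Fin n, ((α i : ℚ) + 1) *
      ((((α + Pi.single i 1 : Fin n → ℕ) j : ℕ) : ℚ) * c (α + Pi.single i 1 - Pi.single j 1))
      = (α j : ℚ) * (((((α - Pi.single j 1 : Fin n → ℕ) i : ℕ) : ℚ) + 1) *
        c (α - Pi.single j 1 + Pi.single i 1)) +
        if i = j then (2 * (α i : ℚ) + 1) * c α else 0 := by
    intro i j
    by_cases hij : i = j
    · subst hij
      have h1 : α + Pi.single i 1 - Pi.single i 1 = α := by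
        funext k; simp
      rw [h1]
      by_cases h0 : α i = 0
      · simp [h0]
      · rw [sub_add_single α i h0]
        have h2 : (α - Pi.single i 1 : Fin n → ℕ) i + 1 = α i := by simp; omega
        have h3 : (((α - Pi.single i 1 : Fin n → ℕ) i : ℕ) : ℚ) + 1 = α i := by exact_mod_cast h2
        rw [h3]
        simp
        ring
    · by_cases h0 : α j = 0
      · simp [h0, hij, Ne.symm hij]
      · have h1 : α + Pi.single i 1 - Pi.single j 1 = α - Pi.single j 1 + Pi.single i 1 := by
          funext k
          by_cases hk : k = j
          · subst hk; simp [Ne.symm hij]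
          · simp [hk]
        rw [h1]
        simp [hij, Ne.symm hij]
        ring
  unfold L S
  simp only [Finset.mul_sum]
  simp_rw [key]
  simp only [Finset.sum_add_distrib]
  rw [Finset.sum_comm]
  congr 1
  simp only [Finset.sum_ite_eq, Finset.mem_univ, if_true]
  rw [← Finset.sum_mul, Finset.sum_add_distrib, ← Finset.mul_sum]
  simp

/-- Eigenvalue of the unscaled composition in weight `N`. -/
def IsEig (n N : ℕ) (r : ℚ) : Prop :=
  ∃ c : (Fin n → ℕ) → ℚ, (∃ α, ∑ i, α i = N ∧ c α ≠ 0) ∧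
    ∀ α, ∑ i, α i = N → L (S c) α = r * c α

lemma eig_le {d N : ℕ} : ∀ {r : ℚ}, IsEig (d + 1) N r →
    ∃ k : ℕ, k ≤ N ∧ r = ((N : ℚ) + 1 - k) * (N + 1 + k + d) := by
  induction N with
  | zero =>
    rintro r ⟨c, ⟨α, hα, hc⟩, h⟩
    refine ⟨0, le_rfl, ?_⟩
    have h1 := h α hα
    rw [comm, hα] at h1
    have h2 : S (L c) α = 0 := by
      unfold S
      apply Finset.sum_eq_zero
      intro j _
      have : α j = 0 := by
        have := (Finset.sum_eq_zero_iff.mp hα) j (Finset.mem_univ j)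
        exact this
      simp [this]
    rw [h2, zero_add] at h1
    have h3 := mul_right_cancel₀ hc h1
    rw [← h3]; push_cast; ring
  | succ N ih =>
    rintro r ⟨c, ⟨α, hα, hc⟩, h⟩
    have hS : ∀ β, ∑ i, β i = N + 1 →
        S (L c) β = (r - (2 * ((N : ℚ) + 1) + (d + 1))) * c β := by
      intro β hβ
      have h1 := h β hβ
      rw [comm, hβ] at h1
      push_cast at h1
      linear_combination h1
    by_cases h0 : ∃ β, ∑ i, β i = N ∧ L c β ≠ 0
    · obtain ⟨k, hk, hr⟩ := ih (r := r - (2 * ((N : ℚ) + 1) + (d + 1))) ⟨L c, h0, by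
        intro β hβ
        conv_lhs => unfold L
        conv_rhs => unfold L
        rw [Finset.mul_sum]
        refine Finset.sum_congr rfl fun j _ => ?_
        have := hS (β + Pi.single j 1) (by rw [weight_add, hβ])
        unfold L at this
        rw [this]
        ring⟩
      refine ⟨k, by omega, ?_⟩
      push_cast
      linear_combination hr
    · push Not at h0
      refine ⟨N + 1, le_rfl, ?_⟩
      have h2 : S (L c) α = 0 := by
        unfold S
        apply Finset.sum_eq_zero
        intro j _
        by_cases hj : α j = 0
        · simp [hj]
        · rw [h0 _ (weight_sub α j hj hα), mul_zero]
      have h3 := hS α hα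
      rw [h2] at h3
      have h4 := (mul_eq_zero.mp h3.symm).resolve_right hc
      push_cast
      linear_combination h4

lemma eig_base (d k : ℕ) : IsEig (d + 2) k (2 * k + d + 2) := by
  let c : (Fin (d + 2) → ℕ) → ℚ := fun α =>
    if ∀ i, i ≠ 0 → i ≠ 1 → α i = 0 then (-1) ^ (α 0) * ((k.choose (α 0) : ℕ) : ℚ) else 0
  refine ⟨c, ⟨Pi.single 1 k, by simp, ?_⟩, ?_⟩
  · have : ∀ i : Fin (d + 2), i ≠ 0 → i ≠ 1 → (Pi.single 1 k : Fin (d + 2) → ℕ) i = 0 := by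
      intro i _ h1; simp [h1]
    simp only [c, if_pos this]
    simp
  · intro α hα
    rw [comm, hα]
    have hL : ∀ β : Fin (d + 2) → ℕ, ∑ i, β i + 1 = k → L c β = 0 := by
      intro β hβ
      unfold L
      by_cases hb : ∀ i, i ≠ 0 → i ≠ 1 → β i = 0
      · have h01 : (1 : Fin (d + 2)) ≠ 0 := by simp
        have hs : β 0 + β 1 + 1 = k := by
          rw [← hβ, Fintype.sum_eq_add 0 1 h01.symm (fun i hi => hb i hi.1 hi.2)]
        rw [Fintype.sum_eq_add 0 1 h01.symm]
        · have e0 : c (β + Pi.single 0 1) = (-1) ^ (β 0 + 1) * ((k.choose (β 0 + 1) : ℕ) : ℚ) := by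
            simp only [c]
            rw [if_pos]
            · simp
            · intro i h0 h1; simp [h0, hb i h0 h1]
          have e1 : c (β + Pi.single 1 1) = (-1) ^ (β 0) * ((k.choose (β 0) : ℕ) : ℚ) := by
            simp only [c]
            rw [if_pos]
            · simp
            · intro i h0 h1; simp [h1, hb i h0 h1]
          rw [e0, e1]
          have h := Nat.choose_succ_right_eq k (β 0)
          have hk : k - β 0 = β 1 + 1 := by omega
          rw [hk] at h
          have h' : ((k.choose (β 0 + 1) : ℕ) : ℚ) * (β 0 + 1) = (k.choose (β 0) : ℕ) * (β 1 + 1) := by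
            exact_mod_cast h
          rw [pow_succ]
          linear_combination (-(-1) ^ (β 0)) * h'
        · rintro i ⟨h0, h1⟩
          have : ¬ ∀ l, l ≠ 0 → l ≠ 1 → (β + Pi.single i 1 : Fin (d + 2) → ℕ) l = 0 := by
            intro h
            have := h i h0 h1
            simp at this
          simp only [c, if_neg this, mul_zero]
      · apply Finset.sum_eq_zero
        intro j _
        have : ¬ ∀ l, l ≠ 0 → l ≠ 1 → (β + Pi.single j 1 : Fin (d + 2) → ℕ) l = 0 := by
          intro h
          apply hb
          intro l h0 h1
          have := h l h0 h1
          simp at this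
          exact this.1
        simp only [c, if_neg this, mul_zero]
    have : S (L c) α = 0 := by
      unfold S
      apply Finset.sum_eq_zero
      intro j _
      by_cases hj : α j = 0
      · simp [hj]
      · rw [hL, mul_zero]
        rw [← weight_add _ j, sub_add_single α j hj, hα]
    rw [this]
    push_cast
    ring

lemma eig_step {n N : ℕ} {r : ℚ} (hr : r ≠ 0) (h : IsEig n N r) :
    IsEig n (N + 1) (r + 2 * (N + 1) + n) := by
  obtain ⟨c, ⟨α, hα, hc⟩, h⟩ := h
  refine ⟨S c, ?_, ?_⟩
  · by_contra hcon
    push Not at hcon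
    have h1 := h α hα
    have : L (S c) α = 0 := by
      unfold L
      apply Finset.sum_eq_zero
      intro j _
      rw [hcon _ (by rw [weight_add, hα]), mul_zero]
    rw [this] at h1
    exact (mul_ne_zero hr hc) h1.symm
  · intro β hβ
    rw [comm, hβ]
    have : S (L (S c)) β = r * S c β := by
      conv_lhs => unfold S
      conv_rhs => unfold S
      rw [Finset.mul_sum]
      refine Finset.sum_congr rfl fun j _ => ?_
      by_cases hj : β j = 0
      · simp [hj]
      · have := h _ (weight_sub β j hj hβ)
        unfold S at this
        rw [this]
        ring
    rw [this]
    push_cast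
    ring

lemma eig_ge (d k m : ℕ) :
    IsEig (d + 2) (k + m) (((m : ℚ) + 1) * (2 * k + m + d + 2)) := by
  induction m with
  | zero => convert eig_base d k using 1 <;> simp
  | succ m ih =>
    have h := eig_step (by positivity) ih
    rw [← add_assoc]
    convert h using 1
    push_cast
    ring

lemma sum_red (n m N : ℕ) (f : (Fin n → ℕ) → ℚ) (α : Fin n → ℕ) (hα : ∑ i, α i = N) :
    ∑ γ ∈ Finset.Nat.antidiagonalTuple n (N + 1), elevEntry n m γ α * f γ = L f α / m := by
  unfold elevEntry L
  simp only [Finset.sum_mul]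
  rw [Finset.sum_comm, Finset.sum_div]
  refine Finset.sum_congr rfl fun j _ => ?_
  simp only [ite_mul, zero_mul]
  rw [Finset.sum_ite_eq', if_pos]
  · ring
  · rw [Finset.Nat.mem_antidiagonalTuple, weight_add, hα]

lemma sum_elev (n m N : ℕ) (c : (Fin n → ℕ) → ℚ) (γ : Fin n → ℕ) (hγ : ∑ i, γ i = N + 1) :
    ∑ α ∈ Finset.Nat.antidiagonalTuple n N, elevEntry n m γ α * c α = S c γ / m := by
  unfold elevEntry S
  simp only [Finset.sum_mul]
  rw [Finset.sum_comm, Finset.sum_div]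
  refine Finset.sum_congr rfl fun j _ => ?_
  simp only [ite_mul, zero_mul]
  by_cases hj : γ j = 0
  · rw [Finset.sum_eq_zero]
    · simp [hj]
    · intro α _
      rw [if_neg]
      intro h
      rw [h] at hj
      simp at hj
  · rw [Finset.sum_eq_single (γ - Pi.single j 1)]
    · rw [if_pos (sub_add_single γ j hj).symm]
      have h2 : (γ - Pi.single j 1 : Fin n → ℕ) j + 1 = γ j := by simp; omega
      have h3 : (((γ - Pi.single j 1 : Fin n → ℕ) j : ℕ) : ℚ) + 1 = γ j := by exact_mod_cast h2
      rw [h3]; ring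
    · intro α _ hne
      rw [if_neg]
      intro h
      apply hne
      rw [h]
      funext k; simp
    · intro h
      exact absurd (Finset.Nat.mem_antidiagonalTuple.mpr (weight_sub γ j hj hγ)) h

lemma mulVec_eq (d N : ℕ) (c : (Fin (d + 1) → ℕ) → ℚ)
    (α : {β : Fin (d + 1) → ℕ // ∑ j, β j = N}) :
    (redElev d N).mulVec (fun β => c β.1) α = L (S c) α.1 / ((N + 1 : ℕ) : ℚ) ^ 2 := by
  have h1 : (redElev d N).mulVec (fun β => c β.1) α =
      ∑ β ∈ Finset.Nat.antidiagonalTuple (d + 1) N,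
        (∑ γ ∈ Finset.Nat.antidiagonalTuple (d + 1) (N + 1),
    elevEntry (d + 1) (N + 1) γ α.1 * elevEntry (d + 1) (N + 1) γ β) * c β := by
    rw [Finset.sum_subtype (p := fun β : Fin (d + 1) → ℕ => ∑ j, β j = N) _
      (fun x => Finset.Nat.mem_antidiagonalTuple)]
    rfl
  rw [h1]
  simp only [Finset.sum_mul]
  rw [Finset.sum_comm]
  have h2 : ∀ γ ∈ Finset.Nat.antidiagonalTuple (d + 1) (N + 1),
      ∑ β ∈ Finset.Nat.antidiagonalTuple (d + 1) N,
        elevEntry (d + 1) (N + 1) γ α.1 * elevEntry (d + 1) (N + 1) γ β * c β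
      = elevEntry (d + 1) (N + 1) γ α.1 * S c γ / ((N + 1 : ℕ) : ℚ) := by
    intro γ hγ
    simp only [mul_assoc]
    rw [← Finset.mul_sum, sum_elev _ _ _ _ _ (Finset.Nat.mem_antidiagonalTuple.mp hγ)]
    ring
  rw [Finset.sum_congr rfl h2, ← Finset.sum_div, sum_red _ _ _ _ _ α.2]
  rw [div_div, pow_two]

lemma mem_spec (d N : ℕ) (r : ℚ) :
    r ∈ spectrum ℚ (redElev d N) ↔ IsEig (d + 1) N (r * ((N + 1 : ℕ) : ℚ) ^ 2) := by
  have hN : (((N + 1 : ℕ) : ℚ) ^ 2) ≠ 0 := by positivity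
  rw [← Matrix.spectrum_toLin', ← Module.End.hasEigenvalue_iff_mem_spectrum]
  constructor
  · intro h
    obtain ⟨v, hv⟩ := h.exists_hasEigenvector
    have h1 := hv.apply_eq_smul
    have h0 := hv.2
    let c : (Fin (d + 1) → ℕ) → ℚ := fun α => if h : ∑ j, α j = N then v ⟨α, h⟩ else 0
    have hc : v = fun β => c β.1 := by
      funext β
      simp [c, β.2]
    refine ⟨c, ?_, ?_⟩
    · by_contra hcon
      push Not at hcon
      apply h0
      rw [hc]
      funext β
      exact hcon β.1 β.2
    · intro α hα
      have h2 := congrFun h1 ⟨α, hα⟩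
      rw [Matrix.toLin'_apply, hc, mulVec_eq] at h2
      simp only [Pi.smul_apply, smul_eq_mul] at h2
      rw [div_eq_iff hN] at h2
      rw [h2]; ring
  · rintro ⟨c, ⟨α, hα, hc⟩, h⟩
    apply Module.End.hasEigenvalue_of_hasEigenvector (x := fun β => c β.1)
    rw [Module.End.hasEigenvector_iff, Module.End.mem_eigenspace_iff]
    refine ⟨?_, ?_⟩
    · funext β
      rw [Matrix.toLin'_apply, mulVec_eq, h _ β.2]
      simp only [Pi.smul_apply, smul_eq_mul]
      field_simp
    · intro h0
      exact hc (congrFun h0 ⟨α, hα⟩)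

end RedElevAux

/-- Spectrum of reduction composed with elevation: for `d ≥ 1` and `N ≥ 0`, the set of
eigenvalues of `(E^{N+1}_N)ᵀ E^{N+1}_N` equals
`{ (N+1−k)(N+1+k+d)/(N+1)² : 0 ≤ k ≤ N }`. -/
theorem stmt10 (d N : ℕ) (hd : 1 ≤ d) :
    spectrum ℚ (redElev d N)
      = {r : ℚ | ∃ k : ℕ, k ≤ N ∧
          r = ((N + 1 - k : ℕ) : ℚ) * ((N + 1 + k + d : ℕ) : ℚ)
            / ((N + 1 : ℕ) : ℚ) ^ 2} := by
  have hN : (((N + 1 : ℕ) : ℚ) ^ 2) ≠ 0 := by positivity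
  ext r
  rw [RedElevAux.mem_spec, Set.mem_setOf_eq]
  constructor
  · intro h
    obtain ⟨k, hk, h⟩ := RedElevAux.eig_le h
    refine ⟨k, hk, ?_⟩
    rw [eq_div_iff hN, h, Nat.cast_sub (by omega)]
    push_cast
    ring
  · rintro ⟨k, hk, rfl⟩
    rw [div_mul_cancel₀ _ hN]
    obtain ⟨m, rfl⟩ := Nat.exists_eq_add_of_le hk
    obtain ⟨e, rfl⟩ := Nat.exists_eq_add_of_le' hd
    convert RedElevAux.eig_ge e k m using 1
    rw [Nat.cast_sub (by omega)]
    push_cast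
    ring
end

section
/- Nonzero generalized eigenvalues of the face mass matrix: let d ≥ 2 and N ≥ 0. Let M^N be the degree-N Bernstein mass matrix on the unit d-simplex T_d and let M^f be the face mass matrix for the face F = {x ∈ T_d : x_1 = 0}, i.e., M^f_{α,γ} := ∫_{T_{d−1}} b^N_α(0,y) b^N_γ(0,y) dy (where (0,y) ∈ ℝ^d has first coordinate 0 and y ∈ T_{d−1}). If u is a nonzero vector and λ ≠ 0 is a real number with M^f u = λ M^N u, then λ = (N+i+d)(N+1−i) for some integer 0 ≤ i ≤ N. -/
open MeasureTheory

open MeasureTheory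

open Polynomial in
lemma oneD_aux (n a : ℕ) (g : ℕ → ℝ) (l G : ℝ) (hG : G ≠ 0)
    (hs : ∑ j : Fin (n + 1), g j = G)
    (h : ∀ k : Fin (n + 1), G = l * ∑ j : Fin (n + 1), g j / ((a : ℝ) + 1 + k + j)) :
    l = ((n : ℝ) + 1) * (n + a + 1) := by
  classical
  let A : ℝ[X] := ∏ m : Fin (n + 1), (X - C (-(m : ℝ)))
  let B : ℝ[X] := ∏ k : Fin (n + 1), (X - C ((a : ℝ) + 1 + k))
  let E : Fin (n + 1) → ℝ[X] := fun j => ∏ m ∈ Finset.univ.erase j, (X - C (-(m : ℝ)))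
  let S : ℝ[X] := ∑ j : Fin (n + 1), C (g j) * E j
  have hA : A.Monic := monic_prod_of_monic _ _ fun i _ => monic_X_sub_C _
  have hB : B.Monic := monic_prod_of_monic _ _ fun i _ => monic_X_sub_C _
  have hE : ∀ j, (E j).Monic := fun j => monic_prod_of_monic _ _ fun i _ => monic_X_sub_C _
  have dA : A.natDegree = n + 1 := by
    simp only [A]; rw [natDegree_prod_of_monic _ _ fun i _ => monic_X_sub_C _]; simp only [natDegree_X_sub_C]; simp
  have dB : B.natDegree = n + 1 := by
    simp only [B]; rw [natDegree_prod_of_monic _ _ fun i _ => monic_X_sub_C _]; simp only [natDegree_X_sub_C]; simp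
  have dE : ∀ j, (E j).natDegree = n := by
    intro j
    simp only [E]; rw [natDegree_prod_of_monic _ _ fun i _ => monic_X_sub_C _]; simp only [natDegree_X_sub_C]; simp
  have dAB : (A - B).natDegree ≤ n := by
    have : (A - B).degree < A.degree := degree_sub_lt_left
      (by rw [degree_eq_natDegree hA.ne_zero, degree_eq_natDegree hB.ne_zero, dA, dB])
      hA.ne_zero (by rw [hA.leadingCoeff, hB.leadingCoeff])
    rw [degree_eq_natDegree hA.ne_zero, dA] at this
    by_cases h0 : A - B = 0
    · simp [h0]
    · exact Nat.lt_succ_iff.1 ((natDegree_lt_iff_degree_lt h0).2 this)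
  have dS : S.natDegree ≤ n := by
    refine natDegree_sum_le_of_forall_le _ _ fun j _ => ?_
    exact (natDegree_C_mul_le _ _).trans (dE j).le
  have hP : C l * S - C G * (A - B) = 0 := by
    refine eq_zero_of_natDegree_lt_card_of_eval_eq_zero _ (ι := Fin (n + 1))
      (f := fun k => (a : ℝ) + 1 + k) ?_ ?_ ?_
    · intro x y hxy
      simpa [Fin.ext_iff] using hxy
    · intro k
      have eB : B.eval ((a : ℝ) + 1 + k) = 0 := by
        simp only [B, eval_prod]
        exact Finset.prod_eq_zero (Finset.mem_univ k) (by simp)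
      have eS : S.eval ((a : ℝ) + 1 + k) =
          A.eval ((a : ℝ) + 1 + k) * ∑ j : Fin (n + 1), g j / ((a : ℝ) + 1 + k + j) := by
        simp only [S, eval_finsetSum, Finset.mul_sum]
        refine Finset.sum_congr rfl fun j _ => ?_
        have : A = (X - C (-(j : ℝ))) * E j := (Finset.mul_prod_erase _ _ (Finset.mem_univ j)).symm
        rw [this]
        have h0 : ((a : ℝ) + 1 + k + j) ≠ 0 := by positivity
        simp only [eval_mul, eval_C, eval_sub, eval_X]
        field_simp
        ring
      simp only [eval_sub, eval_mul, eval_C, eB, eS]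
      have := h k
      linear_combination -A.eval ((a : ℝ) + 1 + k) * this
    · refine Nat.lt_of_le_of_lt (m := n) ?_ (by simp)
      refine (natDegree_sub_le _ _).trans (max_le ?_ ?_)
      · exact (natDegree_C_mul_le _ _).trans dS
      · exact (natDegree_C_mul_le _ _).trans dAB
  have hc := congrArg (fun p => coeff p n) hP
  have cA : A.coeff n = ∑ m : Fin (n + 1), (m : ℝ) := by
    have := prod_X_sub_C_nextCoeff (s := Finset.univ) (fun m : Fin (n + 1) => -(m : ℝ))
    rw [nextCoeff_of_natDegree_pos (by change 0 < A.natDegree; omega)] at this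
    change A.coeff (A.natDegree - 1) = _ at this
    rw [dA] at this
    simpa using this
  have cB : B.coeff n = -∑ m : Fin (n + 1), ((a : ℝ) + 1 + m) := by
    have := prod_X_sub_C_nextCoeff (s := Finset.univ) (fun m : Fin (n + 1) => (a : ℝ) + 1 + m)
    rw [nextCoeff_of_natDegree_pos (by change 0 < B.natDegree; omega)] at this
    change B.coeff (B.natDegree - 1) = _ at this
    rw [dB] at this
    simpa using this
  have cS : S.coeff n = G := by
    simp only [S, finsetSum_coeff, coeff_C_mul]
    rw [← hs]
    refine Finset.sum_congr rfl fun j _ => ?_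
    have := (hE j).coeff_natDegree
    rw [dE] at this
    rw [this, mul_one]
  simp only [coeff_sub, coeff_C_mul, cA, cB, cS, coeff_zero] at hc
  have hsum : ∑ m : Fin (n + 1), (m : ℝ) = n * (n + 1) / 2 := by
    rw [Fin.sum_univ_eq_sum_range (fun m => (m : ℝ))]
    clear * -
    induction n with
    | zero => simp
    | succ n ih => rw [Finset.sum_range_succ, ih]; push_cast; ring
  rw [Finset.sum_add_distrib, hsum] at hc
  simp only [Finset.sum_const, Finset.card_univ, Fintype.card_fin, nsmul_eq_mul] at hc
  push_cast at hc
  apply mul_right_cancel₀ hG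
  linear_combination hc

lemma oneD (n a : ℕ) (g : Polynomial ℝ) (hg : g.natDegree ≤ n) (l : ℝ) (hG : g.eval 1 ≠ 0)
    (h : ∀ k ≤ n, g.eval 1 = l * ∫ t in (0:ℝ)..1, t ^ (a + k) * g.eval t) :
    l = ((n : ℝ) + 1) * (n + a + 1) := by
  refine oneD_aux n a g.coeff l (g.eval 1) hG ?_ ?_
  · rw [Polynomial.eval_eq_sum_range' (Nat.lt_succ_of_le hg), ← Fin.sum_univ_eq_sum_range]
    simp
  · intro k
    rw [h k (by omega)]
    congr 1
    simp_rw [Polynomial.eval_eq_sum_range' (Nat.lt_succ_of_le hg), Finset.mul_sum]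
    rw [intervalIntegral.integral_finsetSum, ← Fin.sum_univ_eq_sum_range]
    · refine Finset.sum_congr rfl fun j _ => ?_
      have : ∀ t : ℝ, t ^ (a + (k : ℕ)) * (g.coeff j * t ^ (j : ℕ)) =
          g.coeff j * t ^ (a + k + j : ℕ) := fun t => by ring
      simp_rw [this]
      rw [intervalIntegral.integral_const_mul, integral_pow]
      simp
      field_simp
      ring
    · intro i _
      apply Continuous.intervalIntegrable
      fun_prop

lemma isCompact_unitSimplex (n : ℕ) : IsCompact (unitSimplex n) := by
  have hc : IsClosed (unitSimplex n) := by
    have : unitSimplex n = (⋂ i, {x | 0 ≤ x i}) ∩ {x | ∑ i, x i ≤ 1} := by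
      ext x; simp [unitSimplex]
    rw [this]
    refine (isClosed_iInter fun i => isClosed_le continuous_const (continuous_apply i)).inter ?_
    exact isClosed_le (by fun_prop) continuous_const
  refine (isCompact_Icc (a := (0 : Fin n → ℝ)) (b := 1)).of_isClosed_subset hc ?_
  rintro x ⟨h0, h1⟩
  refine ⟨h0, fun i => ?_⟩
  exact (Finset.single_le_sum (fun j _ => h0 j) (Finset.mem_univ i)).trans h1

open scoped Pointwise in
lemma smul_unitSimplex (n : ℕ) (t : ℝ) (ht : 0 < t) :
    t • unitSimplex n = {y | (∀ i, 0 ≤ y i) ∧ ∑ i, y i ≤ t} := by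
  ext y
  rw [Set.mem_smul_set_iff_inv_smul_mem₀ ht.ne']
  simp only [unitSimplex, Set.mem_ofPred_eq, Pi.smul_apply, smul_eq_mul, ← Finset.mul_sum]
  have h1 : ∀ a, 0 ≤ t⁻¹ * a ↔ 0 ≤ a := fun a => by
    rw [mul_nonneg_iff_of_pos_left (by positivity)]
  have h2 : ∀ a, t⁻¹ * a ≤ 1 ↔ a ≤ t := fun a => by
    rw [inv_mul_le_iff₀ ht, mul_one]
  simp [h1, h2]

open scoped Pointwise in
lemma integral_simplex_succ (e : ℕ) (f : (Fin (e + 1) → ℝ) → ℝ) (hf : Continuous f) :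
    ∫ x in unitSimplex (e + 1), f x =
      ∫ t in (0:ℝ)..1, t ^ e * ∫ z in unitSimplex e, f (Fin.cons (1 - t) (t • z)) := by
  have hm : MeasurableSet (unitSimplex (e + 1)) :=
    (isCompact_unitSimplex _).isClosed.measurableSet
  have hint : Integrable ((unitSimplex (e + 1)).indicator f) :=
    (hf.continuousOn.integrableOn_compact (isCompact_unitSimplex _)).integrable_indicator hm
  have hmp := (volume_preserving_piFinSuccAbove (fun _ : Fin (e + 1) => ℝ) 0).symm
  rw [← integral_indicator hm, ← hmp.integral_comp' (g := (unitSimplex (e + 1)).indicator f)]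
  rw [show (volume : Measure (ℝ × (Fin e → ℝ))) = volume.prod volume from rfl]
  rw [integral_prod]
  swap
  · exact (hmp.integrable_comp_emb (MeasurableEquiv.measurableEmbedding _)).2 hint
  let F : ℝ → ℝ := fun t => t ^ e * ∫ z in unitSimplex e, f (Fin.cons (1 - t) (t • z))
  have key : ∀ x : ℝ, x ≠ 0 → x ≠ 1 → ∫ y : Fin e → ℝ, (unitSimplex (e + 1)).indicator f
      ((MeasurableEquiv.piFinSuccAbove (fun _ : Fin (e + 1) => ℝ) 0).symm (x, y)) =
      (Set.Ioc (0:ℝ) 1).indicator (fun x => F (1 - x)) x := by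
    intro x hx0 hx1
    have hc : ∀ y : Fin e → ℝ,
        (MeasurableEquiv.piFinSuccAbove (fun _ : Fin (e + 1) => ℝ) 0).symm (x, y) =
        (Fin.cons x y : Fin (e + 1) → ℝ) := fun y => by
      simp [MeasurableEquiv.piFinSuccAbove]
      rfl
    simp_rw [hc]
    by_cases hx : x ∈ Set.Ioc (0:ℝ) 1
    · rw [Set.indicator_of_mem hx]
      have ht : 0 < 1 - x := sub_pos.2 (lt_of_le_of_ne hx.2 hx1)
      have hset : ∀ y : Fin e → ℝ, (unitSimplex (e + 1)).indicator f (Fin.cons x y) =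
          ((1 - x) • unitSimplex e).indicator (fun y => f (Fin.cons x y)) y := by
        intro y
        have hiff : (Fin.cons x y : Fin (e + 1) → ℝ) ∈ unitSimplex (e + 1) ↔
            y ∈ (1 - x) • unitSimplex e := by
          rw [smul_unitSimplex _ _ ht]
          simp only [unitSimplex, Set.mem_ofPred_eq, Fin.forall_fin_succ, Fin.cons_zero,
            Fin.cons_succ, Fin.sum_univ_succ, hx.1.le, true_and]
          rw [le_sub_iff_add_le']
        by_cases h : y ∈ (1 - x) • unitSimplex e
        · rw [Set.indicator_of_mem h, Set.indicator_of_mem (hiff.2 h)]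
        · rw [Set.indicator_of_notMem h, Set.indicator_of_notMem (mt hiff.1 h)]
      simp_rw [hset]
      rw [integral_indicator
        (((isCompact_unitSimplex e).smul (1 - x)).isClosed.measurableSet)]
      simp only [F]
      have := Measure.setIntegral_comp_smul_of_pos volume
        (fun y : Fin e → ℝ => f (Fin.cons x y)) (unitSimplex e) ht
      rw [sub_sub_cancel, this]
      simp only [Module.finrank_fintype_fun_eq_card, Fintype.card_fin, smul_eq_mul]
      field_simp
    · rw [Set.indicator_of_notMem hx]
      have : ∀ y : Fin e → ℝ, (unitSimplex (e + 1)).indicator f (Fin.cons x y) = 0 := by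
        intro y
        apply Set.indicator_of_notMem
        rintro ⟨h0, h1⟩
        apply hx
        have h00 := h0 0
        simp only [Fin.cons_zero] at h00
        refine ⟨lt_of_le_of_ne h00 (Ne.symm hx0), ?_⟩
        have := (Finset.single_le_sum (fun j _ => h0 j) (Finset.mem_univ 0)).trans h1
        simpa using this
      simp [this]
  have hae : ∀ᵐ x : ℝ, ∫ y : Fin e → ℝ, (unitSimplex (e + 1)).indicator f
      ((MeasurableEquiv.piFinSuccAbove (fun _ : Fin (e + 1) => ℝ) 0).symm (x, y)) =
      (Set.Ioc (0:ℝ) 1).indicator (fun x => F (1 - x)) x := by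
    filter_upwards [Measure.ae_ne volume (0:ℝ), Measure.ae_ne volume (1:ℝ)] with x h0 h1
    exact key x h0 h1
  rw [integral_congr_ae hae, integral_indicator measurableSet_Ioc,
    ← intervalIntegral.integral_of_le zero_le_one, intervalIntegral.integral_comp_sub_left]
  simp [F]

lemma sum_bary (n : ℕ) (z : Fin n → ℝ) : ∑ j, bary n z j = 1 := by
  simp [bary, Fin.sum_univ_castSucc]

lemma continuous_bary (n : ℕ) : Continuous (bary n) := by
  refine continuous_pi fun j => ?_
  refine Fin.lastCases ?_ (fun i => ?_) j
  · simp only [bary, Fin.snoc_last]; fun_prop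
  · simp only [bary, Fin.snoc_castSucc]; fun_prop

lemma bary_cons (e : ℕ) (t : ℝ) (z : Fin e → ℝ) :
    bary (e + 1) (Fin.cons (1 - t) (t • z)) = Fin.cons (1 - t) (t • bary e z) := by
  funext j
  refine Fin.cases ?_ (fun j => ?_) j
  · rw [Fin.cons_zero, bary, ← Fin.castSucc_zero, Fin.snoc_castSucc, Fin.cons_zero]
  · rw [Fin.cons_succ]
    refine Fin.lastCases ?_ (fun i => ?_) j
    · rw [Fin.succ_last, bary, Fin.snoc_last]
      simp [bary, Fin.sum_univ_succ, ← Finset.mul_sum]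
      ring
    · rw [Fin.succ_castSucc, bary, Fin.snoc_castSucc, Fin.cons_succ]
      simp [bary]

lemma continuous_evb (n : ℕ) (Q : MvPolynomial (Fin (n + 1)) ℝ) :
    Continuous fun x => MvPolynomial.eval (bary n x) Q :=
  (MvPolynomial.continuous_eval Q).comp (continuous_bary n)

lemma integrable_evb (n : ℕ) (Q : MvPolynomial (Fin (n + 1)) ℝ) :
    IntegrableOn (fun x => MvPolynomial.eval (bary n x) Q) (unitSimplex n) :=
  (continuous_evb n Q).continuousOn.integrableOn_compact (isCompact_unitSimplex n)

/-- Integration of a polynomial in barycentric coordinates over the simplex. -/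
noncomputable def simplexInt (n : ℕ) : MvPolynomial (Fin (n + 1)) ℝ →ₗ[ℝ] ℝ where
  toFun Q := ∫ x in unitSimplex n, MvPolynomial.eval (bary n x) Q
  map_add' p q := by
    simp only [map_add]
    exact integral_add (integrable_evb n p) (integrable_evb n q)
  map_smul' c p := by
    simp only [MvPolynomial.smul_eval, RingHom.id_apply, smul_eq_mul]
    exact integral_const_mul _ _

lemma simplexInt_apply (n : ℕ) (Q : MvPolynomial (Fin (n + 1)) ℝ) :
    simplexInt n Q = ∫ x in unitSimplex n, MvPolynomial.eval (bary n x) Q := rfl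

/-- Slicing substitution. -/
noncomputable def slice (e : ℕ) (t : ℝ) :
    MvPolynomial (Fin (e + 2)) ℝ →ₐ[ℝ] MvPolynomial (Fin (e + 1)) ℝ :=
  MvPolynomial.aeval (Fin.cons (MvPolynomial.C (1 - t))
    (fun j => MvPolynomial.C t * MvPolynomial.X j) : Fin (e + 2) → MvPolynomial (Fin (e + 1)) ℝ)

lemma eval_slice (e : ℕ) (t : ℝ) (w : Fin (e + 1) → ℝ) (Q : MvPolynomial (Fin (e + 2)) ℝ) :
    MvPolynomial.eval w (slice e t Q) = MvPolynomial.eval (Fin.cons (1 - t) (t • w)) Q := by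
  have : (MvPolynomial.aeval w).comp (slice e t) =
      MvPolynomial.aeval (Fin.cons (1 - t) (t • w) : Fin (e + 2) → ℝ) := by
    apply MvPolynomial.algHom_ext
    intro j
    refine Fin.cases ?_ (fun j => ?_) j <;> simp [slice]
  have := DFunLike.congr_fun this Q
  simpa [MvPolynomial.aeval_eq_eval] using this

lemma simplexInt_succ (e : ℕ) (Q : MvPolynomial (Fin (e + 2)) ℝ) :
    simplexInt (e + 1) Q = ∫ t in (0:ℝ)..1, t ^ e * simplexInt e (slice e t Q) := by
  rw [simplexInt_apply, integral_simplex_succ e _ (continuous_evb _ Q)]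
  simp_rw [simplexInt_apply, eval_slice, bary_cons]

lemma exists_test (e N i k : ℕ) (hik : i + k ≤ N) (S : MvPolynomial (Fin (e + 1)) ℝ)
    (hS : S.totalDegree ≤ i) :
    ∃ Q : MvPolynomial (Fin (e + 2)) ℝ, Q.IsHomogeneous N ∧ ∀ t z,
      MvPolynomial.eval (bary e z) (slice e t Q) =
        t ^ (i + k) * MvPolynomial.eval (bary e z) S := by
  classical
  let T : MvPolynomial (Fin (e + 2)) ℝ := ∑ j : Fin (e + 1), MvPolynomial.X j.succ
  let A : MvPolynomial (Fin (e + 2)) ℝ := ∑ j : Fin (e + 2), MvPolynomial.X j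
  have hT : T.IsHomogeneous 1 := MvPolynomial.IsHomogeneous.sum _ _ _ fun j _ =>
    MvPolynomial.isHomogeneous_X _ _
  have hA : A.IsHomogeneous 1 := MvPolynomial.IsHomogeneous.sum _ _ _ fun j _ =>
    MvPolynomial.isHomogeneous_X _ _
  refine ⟨∑ β ∈ S.support, MvPolynomial.C (S.coeff β) * (∏ j, MvPolynomial.X j.succ ^ β j) *
    T ^ (i - (∑ j, β j) + k) * A ^ (N - (i + k)), ?_, ?_⟩
  · refine MvPolynomial.IsHomogeneous.sum _ _ _ fun β hβ => ?_
    have hd : ∑ j, β j ≤ i := by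
      have := MvPolynomial.le_totalDegree hβ
      rw [Finsupp.sum_fintype _ _ (fun _ => rfl)] at this
      omega
    have h1 : (∏ j, (MvPolynomial.X j.succ ^ β j : MvPolynomial (Fin (e + 2)) ℝ)).IsHomogeneous
        (∑ j, β j) := MvPolynomial.IsHomogeneous.prod _ _ _ fun j _ =>
      MvPolynomial.isHomogeneous_X_pow _ _
    have := (((MvPolynomial.isHomogeneous_C (Fin (e + 2)) (S.coeff β)).mul h1).mul
      (hT.pow (i - (∑ j, β j) + k))).mul (hA.pow (N - (i + k)))
    convert this using 1
    omega
  · intro t z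
    rw [eval_slice]
    have hTe : MvPolynomial.eval (Fin.cons (1 - t) (t • bary e z) : Fin (e + 2) → ℝ) T = t := by
      simp [T, ← Finset.mul_sum, sum_bary]
    have hAe : MvPolynomial.eval (Fin.cons (1 - t) (t • bary e z) : Fin (e + 2) → ℝ) A = 1 := by
      simp [A, Fin.sum_univ_succ (n := e + 1), ← Finset.mul_sum, sum_bary]
    rw [MvPolynomial.eval_eq' (bary e z) S, map_sum, Finset.mul_sum]
    refine Finset.sum_congr rfl fun β hβ => ?_
    have hd : ∑ j, β j ≤ i := by
      have := MvPolynomial.le_totalDegree hβ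
      rw [Finsupp.sum_fintype _ _ (fun _ => rfl)] at this
      omega
    simp only [map_mul, map_pow, hTe, hAe, map_prod, MvPolynomial.eval_C, MvPolynomial.eval_X,
      Fin.cons_succ, one_pow, mul_one, Pi.smul_apply, smul_eq_mul, mul_pow,
      Finset.prod_mul_distrib, Finset.prod_pow_eq_pow_sum]
    rw [show i + k = ∑ j, β j + (i - ∑ j, β j + k) by omega, pow_add]
    ring

lemma exists_slice_poly (e N i : ℕ) (P : MvPolynomial (Fin (e + 2)) ℝ)
    (hP : P.IsHomogeneous N) (S : MvPolynomial (Fin (e + 1)) ℝ)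
    (hS : ∀ S' : MvPolynomial (Fin (e + 1)) ℝ, S'.totalDegree < i → simplexInt e (S * S') = 0) :
    ∃ g : Polynomial ℝ, g.natDegree ≤ N - i ∧ ∀ t : ℝ,
      simplexInt e (S * slice e t P) = t ^ i * g.eval t := by
  classical
  let W : (Fin (e + 2) →₀ ℕ) → MvPolynomial (Fin (e + 1)) ℝ :=
    fun s => ∏ j : Fin (e + 1), MvPolynomial.X j ^ s j.succ
  refine ⟨∑ s ∈ P.support, if i + s 0 ≤ N then
    Polynomial.C (P.coeff s * simplexInt e (S * W s)) *
      ((1 - Polynomial.X) ^ s 0 * Polynomial.X ^ (N - i - s 0)) else 0, ?_, ?_⟩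
  · refine Polynomial.natDegree_sum_le_of_forall_le _ _ fun s _ => ?_
    split_ifs with h
    · refine (Polynomial.natDegree_C_mul_le _ _).trans ?_
      refine Polynomial.natDegree_mul_le.trans ?_
      have h1 : ((1 - Polynomial.X : Polynomial ℝ) ^ s 0).natDegree ≤ s 0 := by
        refine Polynomial.natDegree_pow_le.trans ?_
        have : (1 - Polynomial.X : Polynomial ℝ).natDegree ≤ 1 := by
          refine (Polynomial.natDegree_sub_le _ _).trans ?_
          simp
        nlinarith
      rw [Polynomial.natDegree_X_pow]
      omega
    · simp
  · intro t
    have hsl : slice e t P = ∑ s ∈ P.support,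
        (P.coeff s * ((1 - t) ^ s 0 * t ^ (∑ j : Fin (e + 1), s j.succ))) • W s := by
      conv_lhs => rw [P.as_sum]
      rw [map_sum]
      refine Finset.sum_congr rfl fun s _ => ?_
      rw [slice, MvPolynomial.aeval_monomial, Finsupp.prod_fintype _ _ (fun _ => pow_zero _),
        Fin.prod_univ_succ]
      simp only [Fin.cons_zero, Fin.cons_succ, mul_pow, Finset.prod_mul_distrib, W,
        Finset.prod_pow_eq_pow_sum, MvPolynomial.smul_eq_C_mul, MvPolynomial.algebraMap_eq,
        map_mul, map_pow]
      ring
    rw [hsl, Finset.mul_sum, map_sum, Polynomial.eval_finsetSum, Finset.mul_sum]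
    refine Finset.sum_congr rfl fun s hs => ?_
    have hd : s 0 + ∑ j : Fin (e + 1), s j.succ = N := by
      have := hP (MvPolynomial.mem_support_iff.1 hs)
      rw [← this, ← Fin.sum_univ_succ (fun j => s j)]
      simp [Finsupp.weight_apply, Finsupp.sum_fintype]
    rw [mul_smul_comm, map_smul, smul_eq_mul]
    split_ifs with h
    · simp only [Polynomial.eval_mul, Polynomial.eval_C, Polynomial.eval_pow, Polynomial.eval_sub,
        Polynomial.eval_one, Polynomial.eval_X]
      rw [show ∑ j : Fin (e + 1), s j.succ = i + (N - i - s 0) by omega, pow_add]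
      ring
    · rw [hS]
      · simp
      · have : (W s).IsHomogeneous (∑ j : Fin (e + 1), s j.succ) :=
          MvPolynomial.IsHomogeneous.prod _ _ _ fun j _ => MvPolynomial.isHomogeneous_X_pow _ _
        have := this.totalDegree_le
        omega

lemma memLp_evb (n : ℕ) (Q : MvPolynomial (Fin (n + 1)) ℝ) :
    MemLp (fun x => MvPolynomial.eval (bary n x) Q) 2 (volume.restrict (unitSimplex n)) := by
  rw [memLp_two_iff_integrable_sq (continuous_evb n Q).aestronglyMeasurable]
  have := integrable_evb n (Q ^ 2)
  simpa [IntegrableOn] using this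

/-- Polynomials as elements of `L²`. -/
noncomputable def toL2 (n : ℕ) :
    MvPolynomial (Fin (n + 1)) ℝ →ₗ[ℝ] Lp ℝ 2 (volume.restrict (unitSimplex n)) where
  toFun Q := (memLp_evb n Q).toLp
  map_add' p q := by
    rw [← MemLp.toLp_add]
    congr 1
    funext x
    simp
  map_smul' c p := by
    rw [RingHom.id_apply, ← MemLp.toLp_const_smul]
    congr 1
    funext x
    simp

lemma inner_toL2 (n : ℕ) (p q : MvPolynomial (Fin (n + 1)) ℝ) :
    inner ℝ (toL2 n p) (toL2 n q) = simplexInt n (p * q) := by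
  rw [L2.inner_def, simplexInt_apply]
  apply integral_congr_ae
  filter_upwards [(memLp_evb n p).coeFn_toLp, (memLp_evb n q).coeFn_toLp] with x hp hq
  change inner ℝ ((memLp_evb n p).toLp _ x) ((memLp_evb n q).toLp _ x) = _
  rw [hp, hq]
  simp [mul_comm]

lemma exists_orth (n N : ℕ) (r : MvPolynomial (Fin (n + 1)) ℝ) (hr : r.totalDegree ≤ N)
    (h0 : simplexInt n (r * r) ≠ 0) :
    ∃ i ≤ N, ∃ S : MvPolynomial (Fin (n + 1)) ℝ, S.totalDegree ≤ i ∧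
      (∀ S' : MvPolynomial (Fin (n + 1)) ℝ, S'.totalDegree < i → simplexInt n (S * S') = 0) ∧
      simplexInt n (S * r) ≠ 0 := by
  classical
  have hex : ∃ i, ∃ S : MvPolynomial (Fin (n + 1)) ℝ, S.totalDegree ≤ i ∧
      simplexInt n (S * r) ≠ 0 := ⟨N, r, hr, h0⟩
  obtain ⟨S, hS, hSr⟩ := Nat.find_spec hex
  have hmin := fun m => Nat.find_min hex (m := m)
  have hle : Nat.find hex ≤ N := Nat.find_min' hex ⟨r, hr, h0⟩
  generalize Nat.find hex = i at *
  rcases i with _ | i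
  · exact ⟨0, hle, S, hS, fun S' h => absurd h (by omega), hSr⟩
  · let V := (MvPolynomial.restrictTotalDegree (Fin (n + 1)) ℝ i).map (toL2 n)
    obtain ⟨y, hy, z, hz, hyz⟩ := V.exists_add_mem_mem_orthogonal (toL2 n S)
    obtain ⟨Y, hY, rfl⟩ := hy
    have hY : Y.totalDegree ≤ i := (MvPolynomial.mem_restrictTotalDegree _ _ _).1 hY
    refine ⟨i + 1, hle, S - Y, ?_, ?_, ?_⟩
    · exact (MvPolynomial.totalDegree_sub _ _).trans (max_le hS (by omega))
    · intro S' hS'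
      rw [← inner_toL2, map_sub, hyz, add_sub_cancel_left]
      refine Submodule.inner_left_of_mem_orthogonal (K := V) ?_ hz
      exact ⟨S', (MvPolynomial.mem_restrictTotalDegree _ _ _).2 (by omega), rfl⟩
    · have : simplexInt n (Y * r) = 0 := by
        by_contra h
        exact hmin i (by omega) ⟨Y, hY, h⟩
      rw [sub_mul, map_sub, this, sub_zero]
      exact hSr

lemma eval_smul_homog (n N : ℕ) (P : MvPolynomial (Fin (n + 1)) ℝ)
    (hP : P.IsHomogeneous N) (c : ℝ) (y : Fin (n + 1) → ℝ) :
    MvPolynomial.eval (c • y) P = c ^ N * MvPolynomial.eval y P := by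
  rw [MvPolynomial.eval_eq', MvPolynomial.eval_eq', Finset.mul_sum]
  refine Finset.sum_congr rfl fun s hs => ?_
  have hd : ∑ j, s j = N := by
    have := hP (MvPolynomial.mem_support_iff.1 hs)
    rw [← this]
    simp [Finsupp.weight_apply, Finsupp.sum_fintype]
  simp only [Pi.smul_apply, smul_eq_mul, mul_pow, Finset.prod_mul_distrib,
    Finset.prod_pow_eq_pow_sum, hd]
  ring

lemma simplexInt_sq_ne_zero (n N : ℕ) (P : MvPolynomial (Fin (n + 1)) ℝ)
    (hP : P.IsHomogeneous N) (h0 : P ≠ 0) : simplexInt n (P * P) ≠ 0 := by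
  intro h
  apply h0
  rw [simplexInt_apply] at h
  let O : Set (Fin n → ℝ) := {x | (∀ i, 0 < x i) ∧ ∑ i, x i < 1}
  have hO : IsOpen O := by
    have : O = (⋂ i, {x | 0 < x i}) ∩ {x | ∑ i, x i < 1} := by
      ext x; simp [O]
    rw [this]
    refine (isOpen_iInter_of_finite fun i => isOpen_lt continuous_const (continuous_apply i)).inter
      (isOpen_lt (by fun_prop) continuous_const)
  have hOs : O ⊆ unitSimplex n := fun x hx => ⟨fun i => (hx.1 i).le, hx.2.le⟩
  rw [integral_eq_zero_iff_of_nonneg (fun x => by simpa using mul_self_nonneg _)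
    (integrable_evb n (P * P))] at h
  have h' := ae_restrict_of_ae_restrict_of_subset hOs h
  have heq : Set.EqOn (fun x => MvPolynomial.eval (bary n x) (P * P)) 0 O := by
    refine Measure.eqOn_of_ae_eq h' (continuous_evb n _).continuousOn continuousOn_const ?_
    rw [hO.interior_eq]
    exact subset_closure
  refine MvPolynomial.funext_set (fun _ => Set.Ioi (0:ℝ)) (fun _ => Set.Ioi_infinite _) ?_
  intro y hy
  have hy : ∀ j, 0 < y j := fun j => hy j (Set.mem_univ j)
  have hs : 0 < ∑ j, y j := Finset.sum_pos (fun j _ => hy j) Finset.univ_nonempty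
  set σ := ∑ j, y j with hσ
  let x : Fin n → ℝ := fun i => y i.castSucc / σ
  have hb : bary n x = σ⁻¹ • y := by
    funext j
    refine Fin.lastCases ?_ (fun i => ?_) j
    · simp only [bary, Fin.snoc_last, Pi.smul_apply, smul_eq_mul, x]
      rw [← Finset.sum_div, eq_comm, inv_mul_eq_div, eq_sub_iff_add_eq, ← add_div,
        div_eq_one_iff_eq hs.ne', hσ, Fin.sum_univ_castSucc, add_comm]
    · simp only [bary, Fin.snoc_castSucc, Pi.smul_apply, smul_eq_mul, x]
      rw [inv_mul_eq_div]
  have hx : x ∈ O := by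
    refine ⟨fun i => div_pos (hy _) hs, ?_⟩
    have h1 := sum_bary n x
    rw [Fin.sum_univ_castSucc] at h1
    have h2 : 0 < bary n x (Fin.last n) := by
      rw [hb]; exact mul_pos (inv_pos.2 hs) (hy _)
    have h3 : ∀ i : Fin n, bary n x i.castSucc = x i := fun i => by simp [bary]
    simp only [h3] at h1
    linarith
  have h4 := heq hx
  simp only [Pi.zero_apply, map_mul, mul_self_eq_zero] at h4
  have h5 : y = σ • bary n x := by rw [hb, smul_smul, mul_inv_cancel₀ hs.ne', one_smul]
  rw [map_zero, h5, eval_smul_homog n N P hP, h4, mul_zero]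
/-- Nonzero generalized eigenvalues of the face mass matrix on the unit `d`-simplex,
stated with `d = e + 1` (so `d ≥ 2` becomes `e ≥ 1`).  `M^N` is the degree-`N` Bernstein
mass matrix on `T_d` and `M^f` is the face mass matrix for the face
`F = {x ∈ T_d : x_1 = 0}`, with entries `M^f_{α,γ} = ∫_{T_{d−1}} b^N_α(0,y) b^N_γ(0,y) dy`
(where `(0,y) = Fin.cons 0 y`).  If `u` is a nonzero vector (indexed by weight-`N`
multi-indices) and `λ ≠ 0` satisfies `M^f u = λ M^N u`, then
`λ = (N+i+d)(N+1−i)` for some `0 ≤ i ≤ N`. -/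
theorem stmt13 (e N : ℕ) (he : 1 ≤ e)
    (u : (Fin (e + 2) → ℕ) → ℝ) (l : ℝ)
    (hu : ∃ α ∈ Finset.Nat.antidiagonalTuple (e + 2) N, u α ≠ 0) (hl : l ≠ 0)
    (heig : ∀ α ∈ Finset.Nat.antidiagonalTuple (e + 2) N,
      (∑ γ ∈ Finset.Nat.antidiagonalTuple (e + 2) N,
        (∫ y in unitSimplex e,
          bernFn (e + 1) N α (Fin.cons 0 y) * bernFn (e + 1) N γ (Fin.cons 0 y)) * u γ)
      = l * ∑ γ ∈ Finset.Nat.antidiagonalTuple (e + 2) N,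
        (∫ x in unitSimplex (e + 1), bernFn (e + 1) N α x * bernFn (e + 1) N γ x) * u γ) :
    ∃ i : ℕ, i ≤ N ∧ l = ((N + i + (e + 1) : ℕ) : ℝ) * ((N + 1 - i : ℕ) : ℝ) := by
  classical
  set Γ := Finset.Nat.antidiagonalTuple (e + 2) N with hΓ
  let c : (Fin (e + 2) → ℕ) → ℝ := fun α => (N.factorial : ℝ) / ∏ j, ((α j).factorial : ℝ)
  have hc : ∀ α, c α ≠ 0 := fun α => by
    refine div_ne_zero (by positivity) (Finset.prod_ne_zero_iff.2 fun j _ => by positivity)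
  let m : (Fin (e + 2) → ℕ) → (Fin (e + 2) →₀ ℕ) := fun α => Finsupp.equivFunOnFinite.symm α
  let b : (Fin (e + 2) → ℕ) → MvPolynomial (Fin (e + 2)) ℝ :=
    fun α => MvPolynomial.monomial (m α) (c α)
  let P : MvPolynomial (Fin (e + 2)) ℝ := ∑ γ ∈ Γ, u γ • b γ
  have hb : ∀ α x, bernFn (e + 1) N α x = MvPolynomial.eval (bary (e + 1) x) (b α) := by
    intro α x
    simp only [bernFn, b, c, m, MvPolynomial.eval_monomial]
    rw [Finsupp.prod_fintype _ _ (fun _ => pow_zero _)]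
    simp
  have hPh : P.IsHomogeneous N := by
    refine MvPolynomial.IsHomogeneous.sum _ _ _ fun γ hγ => ?_
    rw [MvPolynomial.smul_eq_C_mul]
    refine MvPolynomial.IsHomogeneous.C_mul ?_ _
    refine MvPolynomial.isHomogeneous_monomial _ ?_
    rw [Finsupp.degree_eq_sum]
    simpa [m] using Finset.Nat.mem_antidiagonalTuple.1 hγ
  have hP0 : P ≠ 0 := by
    obtain ⟨α, hα, huα⟩ := hu
    intro h
    have h1 := congrArg (MvPolynomial.coeff (m α)) h
    simp only [P, b, MvPolynomial.coeff_sum, MvPolynomial.coeff_smul,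
      MvPolynomial.coeff_monomial, MvPolynomial.coeff_zero] at h1
    rw [Finset.sum_eq_single α] at h1
    · simp [huα, hc] at h1
    · intro γ _ hne
      rw [if_neg, smul_zero]
      intro h2
      exact hne (Finsupp.equivFunOnFinite.symm.injective h2)
    · intro h2; exact absurd hα h2
  have hmass : ∀ α γ, (∫ x in unitSimplex (e + 1), bernFn (e + 1) N α x * bernFn (e + 1) N γ x)
      = simplexInt (e + 1) (b α * b γ) := by
    intro α γ
    simp only [simplexInt_apply, hb, map_mul]
  have hface : ∀ α γ, (∫ y in unitSimplex e,
          bernFn (e + 1) N α (Fin.cons 0 y) * bernFn (e + 1) N γ (Fin.cons 0 y))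
      = simplexInt e (slice e 1 (b α * b γ)) := by
    intro α γ
    have h1 : ∀ y : Fin e → ℝ, bary (e + 1) (Fin.cons 0 y) =
        (Fin.cons (1 - 1) ((1:ℝ) • bary e y) : Fin (e + 2) → ℝ) := fun y => by
      have := bary_cons e 1 y
      rw [sub_self, one_smul] at this
      rw [this, sub_self]
    simp only [simplexInt_apply, eval_slice, hb, h1, map_mul]
  -- the identity for all homogeneous test polynomials
  let Λ : MvPolynomial (Fin (e + 2)) ℝ →ₗ[ℝ] ℝ :=
    ((simplexInt e).comp (slice e 1).toLinearMap - l • simplexInt (e + 1)).comp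
      (LinearMap.mulRight ℝ P)
  have hΛ : ∀ Q, Λ Q = simplexInt e (slice e 1 (Q * P)) - l * simplexInt (e + 1) (Q * P) :=
    fun Q => rfl
  have hΛb : ∀ α ∈ Γ, Λ (b α) = 0 := by
    intro α hα
    have h1 := heig α hα
    simp only [hmass, hface] at h1
    rw [hΛ, sub_eq_zero]
    simp only [P, Finset.mul_sum, map_sum, mul_smul_comm, map_smul, smul_eq_mul] at h1 ⊢
    simpa only [mul_comm (u _)] using h1
  have hΛQ : ∀ Q : MvPolynomial (Fin (e + 2)) ℝ, Q.IsHomogeneous N → Λ Q = 0 := by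
    intro Q hQ
    rw [Q.as_sum, map_sum]
    refine Finset.sum_eq_zero fun s hs => ?_
    have hd : ∑ j, s j = N := by
      have := hQ (MvPolynomial.mem_support_iff.1 hs)
      rw [← this]
      simp [Finsupp.weight_apply, Finsupp.sum_fintype]
    have h1 : MvPolynomial.monomial s (Q.coeff s) = (Q.coeff s / c s) • b s := by
      simp only [b, m, MvPolynomial.smul_monomial, smul_eq_mul, div_mul_cancel₀ _ (hc s)]
      congr 1
      rw [Finsupp.equivFunOnFinite_symm_coe]
    rw [h1, map_smul, hΛb _ (Finset.Nat.mem_antidiagonalTuple.2 hd), smul_zero]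
  have hr0 : simplexInt e (slice e 1 P * slice e 1 P) ≠ 0 := by
    have h1 := hΛQ P hPh
    rw [hΛ, sub_eq_zero, map_mul] at h1
    rw [h1]
    exact mul_ne_zero hl (simplexInt_sq_ne_zero _ N P hPh hP0)
  have hrd : (slice e 1 P).totalDegree ≤ N := by
    have h1 : (slice e 1 P).IsHomogeneous (1 * N) := by
      refine hPh.aeval _ fun j => ?_
      refine Fin.cases ?_ (fun j => ?_) j
      · rw [Fin.cons_zero, sub_self, map_zero]
        exact MvPolynomial.isHomogeneous_zero _ _ _
      · rw [Fin.cons_succ]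
        exact (MvPolynomial.isHomogeneous_X _ _).C_mul _
    simpa using h1.totalDegree_le
  obtain ⟨i, hiN, S, hSd, hSo, hSr⟩ := exists_orth e N _ hrd hr0
  obtain ⟨g, hgd, hg⟩ := exists_slice_poly e N i P hPh S hSo
  have hg1 : g.eval 1 = simplexInt e (S * slice e 1 P) := by
    rw [hg 1]; simp
  have hmain := oneD (N - i) (e + 2 * i) g hgd l (by rwa [hg1]) (by
    intro k hk
    obtain ⟨Q, hQ, hQe⟩ := exists_test e N i k (by omega) S hSd
    have hsl : ∀ t, simplexInt e (slice e t (Q * P)) =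
        t ^ (i + k) * simplexInt e (S * slice e t P) := by
      intro t
      rw [← smul_eq_mul (t ^ (i + k)), ← map_smul, simplexInt_apply, simplexInt_apply]
      simp only [map_mul, hQe, MvPolynomial.smul_eval, mul_assoc]
    have h1 := hΛQ Q hQ
    rw [hΛ, sub_eq_zero, simplexInt_succ] at h1
    simp only [hsl, one_pow, one_mul] at h1
    rw [hg1, h1]
    congr 2
    funext t
    rw [hg]
    ring)
  refine ⟨i, hiN, ?_⟩
  rw [hmain]
  push_cast [Nat.cast_sub hiN, Nat.cast_sub (show i ≤ N + 1 by omega)]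
  ring
end
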